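/- Let ℓ ∈ {5, 7} and j ≥ 1. If 24n ≡ 2 (mod ℓ^j), then p_2(n) ≡ 0 (mod ℓ^{⌊j/2 - 1⌋}). -/

import Mathlib

noncomputable def partp (n : ℕ) : ℕ := Fintype.card (Nat.Partition n)

noncomputable def partp2 (n : ℕ) : ℕ :=
  ∑ k ∈ Finset.range (n + 1), partp k * partp (n - k)

namespace AtkinTwoColored

open PowerSeries Finset

section GeneratingFunction

open scoped PowerSeries.WithPiTopology

theorem mk_partp_mul_pentagonalSeries :
    (PowerSeries.mk fun n ↦ (partp n : ℤ)) * pentagonalSeries ℤ = 1 := by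
  let _ : TopologicalSpace ℤ := ⊥
  have _ : DiscreteTopology ℤ := ⟨rfl⟩
  have h1 := Nat.Partition.hasProd_powerSeriesMk_card_restricted ℤ (fun _ ↦ True)
  have h2 := WithPiTopology.hasProd_one_sub_X_pow ℤ
  have h3 := h1.mul h2
  have h4 : (PowerSeries.mk fun n ↦ (partp n : ℤ)) =
      PowerSeries.mk fun n ↦ ((#(Nat.Partition.restricted n fun _ ↦ True) : ℕ) : ℤ) := by
    ext n
    simp [partp, Nat.Partition.restricted]
  rw [h4]
  have h5 : (fun i ↦ (if True then ∑' j : ℕ, (X ^ ((i + 1) * j) : ℤ⟦X⟧) else 1) *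
      (1 - X ^ (i + 1))) = fun _ ↦ 1 := by
    funext i
    rw [if_pos trivial]
    simp_rw [pow_mul]
    exact WithPiTopology.tsum_pow_mul_one_sub_of_constantCoeff_eq_zero (by simp)
  rw [h5] at h3
  exact h3.unique hasProd_one

theorem mk_partp2_eq_sq :
    (PowerSeries.mk fun n ↦ (partp2 n : ℤ)) = (PowerSeries.mk fun n ↦ (partp n : ℤ)) ^ 2 := by
  ext n
  rw [sq, coeff_mul, Finset.Nat.sum_antidiagonal_eq_sum_range_succ_mk]
  simp [partp2]

end GeneratingFunction

section JacobiCube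

variable {K : Type*} [Field K]

/-- The finite Euler product `(1 - q)(1 - q²)⋯(1 - qᵐ)`. -/
noncomputable def qFactorial (K : Type*) [Field K] (m : ℕ) : K⟦X⟧ :=
  ∏ i ∈ range m, (1 - X ^ (i + 1))

theorem qFactorial_succ (m : ℕ) :
    qFactorial K (m + 1) = qFactorial K m * (1 - X ^ (m + 1)) := prod_range_succ _ _

theorem constantCoeff_qFactorial (m : ℕ) : constantCoeff (qFactorial K m) = 1 := by
  simp [qFactorial, map_prod]

theorem qFactorial_mul_inv (m : ℕ) : qFactorial K m * (qFactorial K m)⁻¹ = 1 :=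
  PowerSeries.mul_inv_cancel _ (by simp [constantCoeff_qFactorial])

/-- The reciprocal of the `q`-factorial of `m - 2`, extended by zero. -/
noncomputable def qFactorialInv (K : Type*) [Field K] : ℕ → K⟦X⟧
  | 0 => 0
  | 1 => 0
  | m + 2 => (qFactorial K m)⁻¹

theorem qFactorialInv_succ (m : ℕ) :
    qFactorialInv K (m + 1) = (1 - X ^ m) * qFactorialInv K (m + 2) := by
  cases m with
  | zero => simp [qFactorialInv]
  | succ m =>
    simp only [qFactorialInv]
    have h1 := qFactorial_mul_inv (K := K) m
    have h2 := qFactorial_mul_inv (K := K) (m + 1)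
    rw [qFactorial_succ] at h2 ⊢
    linear_combination (1 - X ^ (m + 1)) * (qFactorial K m * (1 - X ^ (m + 1)))⁻¹ * h1 -
      (qFactorial K m)⁻¹ * h2

theorem triangle_succ (k : ℕ) : (k + 1) * (k + 1 + 1) / 2 = k * (k + 1) / 2 + (k + 1) := by
  rw [show (k + 1) * (k + 1 + 1) = k * (k + 1) + 2 * (k + 1) by ring,
    Nat.add_mul_div_left _ _ two_pos]

/-- The coefficient of `zᵏ` in the finite Jacobi triple product
`∏ (1 - z qⁱ) ∏ (1 - z⁻¹ qⁱ⁻¹)`. -/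
noncomputable def tripleCoeff (K : Type*) [Field K] (n k : ℕ) : K⟦X⟧ :=
  (-1) ^ k * X ^ (k * (k + 1) / 2) * qFactorial K (2 * n + 1) *
    qFactorialInv K (n + 2 - k) * qFactorialInv K (n + k + 3)

theorem tripleCoeff_eq_zero {n k : ℕ} (h : n < k) : tripleCoeff K n k = 0 := by
  have h' : n + 2 - k = 0 ∨ n + 2 - k = 1 := by omega
  rcases h' with h' | h' <;> simp [tripleCoeff, h', qFactorialInv]

theorem tripleCoeff_succ_zero (n : ℕ) :
    tripleCoeff K (n + 1) 0 = (1 + X ^ (2 * n + 2)) * tripleCoeff K n 0 +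
      X ^ (n + 1) * tripleCoeff K n 0 - X ^ (n + 1) * tripleCoeff K n 1 := by
  simp only [tripleCoeff]
  rw [show 2 * (n + 1) + 1 = 2 * n + 1 + 1 + 1 by ring, qFactorial_succ, qFactorial_succ,
    show n + 1 + 2 - 0 = n + 1 + 2 by omega, show n + 1 + 0 + 3 = n + 2 + 2 by omega,
    show n + 2 - 0 = n + 1 + 1 by omega, show n + 0 + 3 = n + 2 + 1 by omega,
    show n + 2 - 1 = n + 1 by omega, show n + 1 + 3 = n + 2 + 2 by omega,
    qFactorialInv_succ n, qFactorialInv_succ (n + 1), qFactorialInv_succ (n + 2)]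
  norm_num
  ring

theorem tripleCoeff_succ_succ (n k : ℕ) :
    tripleCoeff K (n + 1) (k + 1) = (1 + X ^ (2 * n + 2)) * tripleCoeff K n (k + 1) -
      X ^ (n + 1) * tripleCoeff K n k - X ^ (n + 1) * tripleCoeff K n (k + 2) := by
  rcases lt_or_ge n k with h | h
  · rw [tripleCoeff_eq_zero (by omega), tripleCoeff_eq_zero (by omega),
      tripleCoeff_eq_zero (by omega), tripleCoeff_eq_zero (by omega)]
    ring
  obtain ⟨d, rfl⟩ := Nat.exists_eq_add_of_le h
  simp only [tripleCoeff]
  rw [show 2 * (k + d + 1) + 1 = 2 * (k + d) + 1 + 1 + 1 by ring, qFactorial_succ,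
    qFactorial_succ, show k + d + 1 + 2 - (k + 1) = d + 2 by omega,
    show k + d + 1 + (k + 1) + 3 = 2 * k + d + 3 + 2 by omega,
    show k + d + 2 - (k + 1) = d + 1 by omega,
    show k + d + (k + 1) + 3 = 2 * k + d + 3 + 1 by omega,
    show k + d + 2 - k = d + 2 by omega,
    show k + d + k + 3 = 2 * k + d + 2 + 1 by omega,
    show k + d + 2 - (k + 2) = d by omega,
    show k + d + (k + 2) + 3 = 2 * k + d + 3 + 2 by omega,
    qFactorialInv_succ (2 * k + d + 3), qFactorialInv_succ (2 * k + d + 2),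
    show 2 * k + d + 2 + 2 = 2 * k + d + 3 + 1 by omega,
    qFactorialInv_succ (2 * k + d + 3), triangle_succ (k + 1), triangle_succ k]
  cases d with
  | zero =>
    simp only [qFactorialInv]
    ring
  | succ e =>
    rw [qFactorialInv_succ e, show e + 1 + 1 = e + 2 by omega,
      show qFactorialInv K (e + 2) = (1 - X ^ (e + 1)) * qFactorialInv K (e + 1 + 2) from
      qFactorialInv_succ (e + 1)]
    ring

theorem sum_tripleCoeff_succ (n N : ℕ) :
    ∑ k ∈ range (N + 1), (2 * k + 1) * tripleCoeff K (n + 1) k =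
      (1 - X ^ (n + 1)) ^ 2 * ∑ k ∈ range (N + 1), (2 * k + 1) * tripleCoeff K n k +
        X ^ (n + 1) * ((2 * (N : K⟦X⟧) + 3) * tripleCoeff K n N - (2 * (N : K⟦X⟧) + 1) * tripleCoeff K n (N + 1)) := by
  induction N with
  | zero =>
    simp only [zero_add, sum_range_one, tripleCoeff_succ_zero, Nat.cast_zero]
    ring
  | succ N ih =>
    rw [sum_range_succ, ih, sum_range_succ _ (N + 1), tripleCoeff_succ_succ]
    push_cast
    ring

theorem sum_tripleCoeff (n N : ℕ) (h : n ≤ N) :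
    ∑ k ∈ range (N + 1), (2 * k + 1) * tripleCoeff K n k = qFactorial K n ^ 2 := by
  induction n with
  | zero =>
    rw [sum_eq_single_of_mem 0 (by simp) fun k _ hk ↦ by
      rw [tripleCoeff_eq_zero (by omega), mul_zero]]
    simp only [tripleCoeff, qFactorialInv, qFactorial]
    simp
  | succ n ih =>
    rw [sum_tripleCoeff_succ, ih (by omega), tripleCoeff_eq_zero (by omega : n < N),
      tripleCoeff_eq_zero (by omega : n < N + 1), qFactorial_succ]
    ring

theorem X_pow_dvd_qFactorial_sub (m n : ℕ) (h : m ≤ n) :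
    (X : K⟦X⟧) ^ (m + 1) ∣ qFactorial K n - qFactorial K m := by
  induction n, h using Nat.le_induction with
  | base => simp
  | succ n hn ih =>
    have : qFactorial K (n + 1) - qFactorial K m =
        (qFactorial K n - qFactorial K m) - X ^ (n + 1) * qFactorial K n := by
      rw [qFactorial_succ]; ring
    rw [this]
    exact dvd_sub ih (Dvd.dvd.mul_right (pow_dvd_pow _ (by omega)) _)

theorem X_pow_dvd_pentagonalSeries_sub (n : ℕ) :
    (X : K⟦X⟧) ^ (n + 1) ∣ pentagonalSeries K - qFactorial K n := by
  rw [X_pow_dvd_iff]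
  intro d hd
  have h1 := Filter.tendsto_finset_range.eventually (coeff_prod_one_sub_X_pow_eventually_eq K d)
  obtain ⟨N, hN⟩ := Filter.eventually_atTop.mp h1
  have h2 : (qFactorial K (max N n)).coeff d = _ := hN (max N n) (le_max_left _ _)
  have h3 := X_pow_dvd_iff.mp (X_pow_dvd_qFactorial_sub (K := K) n (max N n) (le_max_right _ _)) d hd
  rw [map_sub] at h3 ⊢
  rw [← h2, h3]

theorem X_pow_dvd_tripleCoeff_mul_sub (n k : ℕ) (h : k ≤ n) :
    (X : K⟦X⟧) ^ (n + 1) ∣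
      tripleCoeff K n k * qFactorial K n - (-1) ^ k * X ^ (k * (k + 1) / 2) := by
  have hT : k ≤ k * (k + 1) / 2 := by
    rw [Nat.le_div_iff_mul_le two_pos]
    rcases Nat.eq_zero_or_pos k with rfl | hk <;> nlinarith
  have h1 := X_pow_dvd_qFactorial_sub (K := K) (n - k) n (by omega)
  have h2 : (X : K⟦X⟧) ^ (n - k + 1) ∣ qFactorial K (2 * n + 1) - qFactorial K (n + k + 1) :=
    (pow_dvd_pow _ (by omega)).trans (X_pow_dvd_qFactorial_sub (n + k + 1) (2 * n + 1) (by omega))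
  have h3 : (X : K⟦X⟧) ^ (n - k + 1) ∣ qFactorial K (2 * n + 1) * qFactorial K n -
      qFactorial K (n + k + 1) * qFactorial K (n - k) := by
    have := dvd_add (h2.mul_right (qFactorial K n)) (h1.mul_left (qFactorial K (n + k + 1)))
    convert this using 1
    ring
  have h4 : (X : K⟦X⟧) ^ (k * (k + 1) / 2 + (n - k + 1)) ∣
      tripleCoeff K n k * qFactorial K n - (-1) ^ k * X ^ (k * (k + 1) / 2) := by
    rw [pow_add]
    have h5 := (mul_dvd_mul_left (X ^ (k * (k + 1) / 2)) h3).mul_right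
      ((-1) ^ k * (qFactorial K (n + k + 1))⁻¹ * (qFactorial K (n - k))⁻¹)
    convert h5 using 1
    simp only [tripleCoeff]
    rw [show n + 2 - k = n - k + 2 by omega, show n + k + 3 = n + k + 1 + 2 by omega]
    simp only [qFactorialInv]
    have e1 := qFactorial_mul_inv (K := K) (n + k + 1)
    have e2 := qFactorial_mul_inv (K := K) (n - k)
    linear_combination (-1) ^ k * X ^ (k * (k + 1) / 2) *
      (e1 + qFactorial K (n + k + 1) * (qFactorial K (n + k + 1))⁻¹ * e2)
  exact (pow_dvd_pow _ (by omega)).trans h4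

/-- The support part of Jacobi's identity for the cube of the Euler function. -/
theorem coeff_pentagonalSeries_pow_three_eq_zero (n : ℕ) (h : ∀ k, k * (k + 1) / 2 ≠ n) :
    (pentagonalSeries K ^ 3).coeff n = 0 := by
  have h1 : (X : K⟦X⟧) ^ (n + 1) ∣ pentagonalSeries K ^ 3 - qFactorial K n ^ 3 :=
    (X_pow_dvd_pentagonalSeries_sub n).trans (sub_dvd_pow_sub_pow _ _ 3)
  have h2 : (X : K⟦X⟧) ^ (n + 1) ∣ ∑ k ∈ range (n + 1), ((2 * k + 1 : ℕ) : K⟦X⟧) *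
      (tripleCoeff K n k * qFactorial K n - (-1) ^ k * X ^ (k * (k + 1) / 2)) :=
    dvd_sum fun k hk ↦ (X_pow_dvd_tripleCoeff_mul_sub n k (by simp at hk; omega)).mul_left _
  have h3 : qFactorial K n ^ 3 =
      ∑ k ∈ range (n + 1), ((2 * k + 1 : ℕ) : K⟦X⟧) * (tripleCoeff K n k * qFactorial K n) := by
    rw [pow_succ, ← sum_tripleCoeff n n le_rfl, sum_mul]
    exact sum_congr rfl fun k _ ↦ by push_cast; ring
  have h4 := X_pow_dvd_iff.mp (dvd_add h1 h2) n (by omega)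
  simp_rw [mul_sub] at h4
  rw [sum_sub_distrib, ← h3, sub_add_sub_cancel, map_sub, sub_eq_zero] at h4
  rw [h4, map_sum]
  refine sum_eq_zero fun k _ ↦ ?_
  have h5 : ((2 * k + 1 : ℕ) : K⟦X⟧) * ((-1) ^ k * X ^ (k * (k + 1) / 2)) =
      C (((2 * k + 1 : ℕ) : K) * (-1) ^ k) * X ^ (k * (k + 1) / 2) := by
    rw [map_mul, map_pow, map_natCast, map_neg, map_one, mul_assoc]
  rw [h5, coeff_C_mul, coeff_X_pow, if_neg (h k).symm, mul_zero]

end JacobiCube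

section Dissection

variable {R : Type*} [CommRing R] {ℓ : ℕ}

/-- The power series `f` is supported on exponents congruent to `c` modulo `ℓ`. -/
def IsSupportedOn (f : R⟦X⟧) (c : ZMod ℓ) : Prop := ∀ n : ℕ, (n : ZMod ℓ) ≠ c → coeff n f = 0

namespace IsSupportedOn

variable {f g : R⟦X⟧} {c d : ZMod ℓ}

theorem congr (hf : IsSupportedOn f c) (h : c = d) : IsSupportedOn f d := h ▸ hf

theorem mul (hf : IsSupportedOn f c) (hg : IsSupportedOn g d) : IsSupportedOn (f * g) (c + d) := by
  intro n hn
  rw [coeff_mul]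
  refine sum_eq_zero fun p hp ↦ ?_
  by_cases h1 : (p.1 : ZMod ℓ) = c
  · by_cases h2 : (p.2 : ZMod ℓ) = d
    · rw [HasAntidiagonal.mem_antidiagonal] at hp
      exact absurd (by rw [← hp, Nat.cast_add, h1, h2]) hn
    · rw [hg _ h2, mul_zero]
  · rw [hf _ h1, zero_mul]

theorem one : IsSupportedOn (1 : R⟦X⟧) (0 : ZMod ℓ) := by
  intro n hn
  rw [coeff_one, if_neg]
  rintro rfl
  simp at hn

theorem pow (hf : IsSupportedOn f c) (k : ℕ) : IsSupportedOn (f ^ k) ((k : ZMod ℓ) * c) := by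
  induction k with
  | zero => simpa using one
  | succ k ih =>
    rw [pow_succ]
    exact (ih.mul hf).congr (by push_cast; ring)

theorem add (hf : IsSupportedOn f c) (hg : IsSupportedOn g c) : IsSupportedOn (f + g) c := by
  intro n hn
  rw [map_add, hf n hn, hg n hn, add_zero]

theorem neg (hf : IsSupportedOn f c) : IsSupportedOn (-f) c := by
  intro n hn
  rw [map_neg, hf n hn, neg_zero]

theorem sub (hf : IsSupportedOn f c) (hg : IsSupportedOn g c) : IsSupportedOn (f - g) c := by
  rw [sub_eq_add_neg]
  exact hf.add hg.neg

theorem ofNat_mul (hf : IsSupportedOn f c) (k : ℕ) [k.AtLeastTwo] :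
    IsSupportedOn ((OfNat.ofNat k : R⟦X⟧) * f) c := by
  intro n hn
  have : (OfNat.ofNat k : R⟦X⟧) * f = k • f := by
    rw [nsmul_eq_mul]
    exact congrArg (· * f) (Nat.cast_ofNat (R := R⟦X⟧) (n := k)).symm
  rw [this, map_nsmul, hf n hn, smul_zero]

theorem expand (hℓ : ℓ ≠ 0) : IsSupportedOn (expand ℓ hℓ f) (0 : ZMod ℓ) := by
  intro n hn
  rw [coeff_expand_of_not_dvd]
  rwa [Ne, ZMod.natCast_eq_zero_iff] at hn

theorem X_pow (k : ℕ) : IsSupportedOn (X ^ k : R⟦X⟧) (k : ZMod ℓ) := by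
  intro n hn
  rw [coeff_X_pow, if_neg]
  rintro rfl
  exact hn rfl

end IsSupportedOn

theorem eq_zero_of_sum_isSupportedOn [NeZero ℓ] {f : R⟦X⟧} {h : ZMod ℓ → R⟦X⟧} (hf : f = ∑ c, h c)
    (hh : ∀ c, IsSupportedOn (h c) c) {c : ZMod ℓ} (hc : ∀ n : ℕ, (n : ZMod ℓ) = c → coeff n f = 0) :
    h c = 0 := by
  ext n
  by_cases hn : (n : ZMod ℓ) = c
  · have h1 := hc n hn
    rw [hf, map_sum, sum_eq_single c] at h1
    · simpa using h1
    · intro b _ hb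
      exact hh b n (fun h ↦ hb (h ▸ hn))
    · simp
  · rw [hh c n hn, map_zero]

/-- The part of a power series supported on exponents congruent to `c` modulo `ℓ`. -/
noncomputable def residuePart (f : R⟦X⟧) (c : ZMod ℓ) : R⟦X⟧ :=
  PowerSeries.mk fun n ↦ if (n : ZMod ℓ) = c then coeff n f else 0

theorem isSupportedOn_residuePart (f : R⟦X⟧) (c : ZMod ℓ) : IsSupportedOn (residuePart f c) c := by
  intro n hn
  rw [residuePart, coeff_mk, if_neg hn]

theorem sum_residuePart [NeZero ℓ] (f : R⟦X⟧) : ∑ c : ZMod ℓ, residuePart f c = f := by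
  ext n
  simp [residuePart]

theorem residuePart_pentagonalSeries_eq_zero {c : ZMod ℓ} (h : ∀ k, (pentagonal k : ZMod ℓ) ≠ c) :
    residuePart (pentagonalSeries R) c = 0 := by
  ext n
  rw [residuePart, coeff_mk, map_zero]
  split_ifs with hn
  · apply coeff_pentagonalSeries_eq_zero
    rintro ⟨k, rfl⟩
    exact h k hn
  · rfl

/-- The series `X ^ d * E(X ^ ℓ²)` with `E` the Euler function. -/
noncomputable def eulerShift (R : Type*) [CommRing R] (ℓ : ℕ) (hℓ : ℓ ≠ 0) (d : ℕ) : R⟦X⟧ :=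
  X ^ d * expand ℓ hℓ (expand ℓ hℓ (pentagonalSeries R))

theorem isSupportedOn_eulerShift (hℓ : ℓ ≠ 0) (d : ℕ) :
    IsSupportedOn (eulerShift R ℓ hℓ d) (d : ZMod ℓ) :=
  ((IsSupportedOn.X_pow d).mul (IsSupportedOn.expand hℓ)).congr (add_zero _)

theorem residuePart_pentagonalSeries_eq_neg (hℓ : ℓ ≠ 0) (d : ℕ) (s : ℤ → ℤ)
    (h1 : ∀ m, pentagonal (s m) = ℓ * (ℓ * pentagonal m) + d)
    (h2 : ∀ k, (pentagonal k : ZMod ℓ) = d → ∃ m, k = s m)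
    (h3 : ∀ m, Int.negOnePow (s m) = - Int.negOnePow m) :
    residuePart (pentagonalSeries R) (d : ZMod ℓ) = -eulerShift R ℓ hℓ d := by
  ext n
  by_cases hn : (n : ZMod ℓ) = d
  swap
  · rw [isSupportedOn_residuePart _ _ n hn, map_neg, isSupportedOn_eulerShift hℓ d n hn, neg_zero]
  rw [residuePart, coeff_mk, if_pos hn]
  by_cases hp : n ∈ Set.range pentagonal
  · obtain ⟨k, rfl⟩ := hp
    obtain ⟨m, rfl⟩ := h2 k hn
    rw [coeff_pentagonalSeries_pentagonal, map_neg, eulerShift, h1, coeff_X_pow_mul,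
      coeff_expand_mul, coeff_expand_mul, coeff_pentagonalSeries_pentagonal, h3]
    simp
  · rw [coeff_pentagonalSeries_eq_zero _ hp, map_neg, eulerShift, coeff_X_pow_mul', eq_comm,
      neg_eq_zero]
    split_ifs with hd
    · rw [coeff_expand]
      split_ifs with h4
      · rw [coeff_expand]
        split_ifs with h5
        · apply coeff_pentagonalSeries_eq_zero
          rintro ⟨m, hm⟩
          apply hp
          refine ⟨s m, ?_⟩
          rw [h1, hm, Nat.mul_div_cancel' h5, Nat.mul_div_cancel' h4, Nat.sub_add_cancel hd]
        · rfl
      · rfl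
    · rfl

theorem two_mul_pentagonal_zmod (ℓ : ℕ) (k : ℤ) :
    (2 : ZMod ℓ) * (pentagonal k : ZMod ℓ) = k * (3 * k - 1) := by
  have := congrArg (Int.cast : ℤ → ZMod ℓ) (two_mul_natCast_pentagonal k)
  push_cast at this
  exact this

theorem triangle_zmod (ℓ k : ℕ) :
    (2 : ZMod ℓ) * ((k * (k + 1) / 2 : ℕ) : ZMod ℓ) = k * (k + 1) := by
  have h : 2 * (k * (k + 1) / 2) = k * (k + 1) := Nat.mul_div_cancel' (Nat.even_mul_succ_self k).two_dvd
  have := congrArg (Nat.cast : ℕ → ZMod ℓ) h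
  push_cast at this
  exact this

end Dissection

section Five

variable {K : Type*} [Field K]

theorem residuePart_five_one : residuePart (pentagonalSeries K) (1 : ZMod 5) =
    -eulerShift K 5 (by norm_num) 1 := by
  have := residuePart_pentagonalSeries_eq_neg (R := K) (ℓ := 5) (by norm_num) 1 (fun m ↦ 1 - 5 * m)
    ?_ ?_ ?_
  · simpa using this
  · intro m
    have h1 := two_mul_natCast_pentagonal (1 - 5 * m)
    have h2 := two_mul_natCast_pentagonal m
    zify
    linarith
  · intro k hk
    have h := two_mul_pentagonal_zmod 5 k
    rw [hk] at h
    have h' : ∀ x : ZMod 5, (2 : ZMod 5) * (1 : ℕ) = x * (3 * x - 1) → x = 1 := by decide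
    have h2 := h' _ h
    have h3 : ((k : ℤ) : ZMod 5) = ((1 : ℤ) : ZMod 5) := by simpa using h2
    rw [ZMod.intCast_eq_intCast_iff_dvd_sub] at h3
    obtain ⟨m, hm⟩ := h3
    exact ⟨m, by push_cast at hm; linarith⟩
  · intro m
    rw [Int.negOnePow_sub, Int.negOnePow_one, Int.negOnePow_eq_iff _ _ |>.2 (?_ : Even (5 * m - m))]
    · simp
    · exact ⟨2 * m, by ring⟩

theorem residuePart_five_eq_zero {c : ZMod 5} (hc : ∀ x : ZMod 5, 2 * c ≠ x * (3 * x - 1)) :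
    residuePart (pentagonalSeries K) c = 0 := by
  refine residuePart_pentagonalSeries_eq_zero fun k hk ↦ hc k ?_
  rw [← hk]
  exact two_mul_pentagonal_zmod 5 k

theorem coeff_pentagonalSeries_pow_three_eq_zero_of_zmod {ℓ : ℕ} {c : ZMod ℓ}
    (hc : ∀ x : ZMod ℓ, 2 * c ≠ x * (x + 1)) (n : ℕ) (hn : (n : ZMod ℓ) = c) :
    coeff n (pentagonalSeries K ^ 3) = 0 := by
  refine coeff_pentagonalSeries_pow_three_eq_zero n fun k hk ↦ hc k ?_
  rw [← hn, ← hk]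
  exact triangle_zmod ℓ k

theorem coeff_zero_residuePart {ℓ : ℕ} :
    coeff 0 (residuePart (pentagonalSeries K) (0 : ZMod ℓ)) = 1 := by
  have h := coeff_pentagonalSeries_pentagonal K 0
  rw [show pentagonal 0 = 0 from rfl] at h
  rw [residuePart, coeff_mk, if_pos (by simp), h]
  simp

theorem exists_dissection_five [CharZero K] : ∃ a c : K⟦X⟧,
    IsSupportedOn a (0 : ZMod 5) ∧ IsSupportedOn c (2 : ZMod 5) ∧
    pentagonalSeries K = a + c - eulerShift K 5 (by norm_num) 1 ∧
    a * c = -eulerShift K 5 (by norm_num) 1 ^ 2 := by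
  set E := pentagonalSeries K with hE
  set a := residuePart E (0 : ZMod 5) with ha'
  set c := residuePart E (2 : ZMod 5) with hc'
  set D := eulerShift K 5 (by norm_num) 1
  have ha : IsSupportedOn a (0 : ZMod 5) := isSupportedOn_residuePart _ _
  have hc : IsSupportedOn c (2 : ZMod 5) := isSupportedOn_residuePart _ _
  have hD : IsSupportedOn D (1 : ZMod 5) := by simpa using isSupportedOn_eulerShift (R := K) (ℓ := 5) (by norm_num) 1
  have hsum : E = a + c - D := by
    have h := sum_residuePart (ℓ := 5) E
    have h3 : residuePart E (3 : ZMod 5) = 0 := residuePart_five_eq_zero (by decide)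
    have h4 : residuePart E (4 : ZMod 5) = 0 := residuePart_five_eq_zero (by decide)
    have h5 : ∑ x : ZMod 5, residuePart E x = residuePart E (0 : ZMod 5) + residuePart E (1 : ZMod 5) +
      residuePart E (2 : ZMod 5) + residuePart E (3 : ZMod 5) + residuePart E (4 : ZMod 5) :=
      Fin.sum_univ_five _
    rw [h5, h3, h4, residuePart_five_one] at h
    rw [← h]
    ring
  refine ⟨a, c, ha, hc, hsum, ?_⟩
  let h : ZMod 5 → K⟦X⟧ := ![a ^ 3 - 3 * (c ^ 2 * D), c ^ 3 - 3 * (a ^ 2 * D), 3 * (a ^ 2 * c) + 3 * (a * D ^ 2),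
    -D ^ 3 - 6 * (a * (c * D)), 3 * (a * c ^ 2) + 3 * (c * D ^ 2)]
  have h2 : h 2 = 0 := by
    refine eq_zero_of_sum_isSupportedOn (f := E ^ 3) ?_ ?_ (coeff_pentagonalSeries_pow_three_eq_zero_of_zmod (by decide))
    · rw [hsum, show ∑ c, h c = h 0 + h 1 + h 2 + h 3 + h 4 from Fin.sum_univ_five _]
      change _ = (a ^ 3 - 3 * (c ^ 2 * D)) + (c ^ 3 - 3 * (a ^ 2 * D)) + (3 * (a ^ 2 * c) + 3 * (a * D ^ 2)) +
        (-D ^ 3 - 6 * (a * (c * D))) + (3 * (a * c ^ 2) + 3 * (c * D ^ 2))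
      ring
    · intro x
      fin_cases x
      · change IsSupportedOn _ (0 : ZMod 5)
        exact ((ha.pow 3).congr (by decide)).sub ((((hc.pow 2).mul hD).ofNat_mul 3).congr (by decide))
      · change IsSupportedOn _ (1 : ZMod 5)
        exact ((hc.pow 3).congr (by decide)).sub ((((ha.pow 2).mul hD).ofNat_mul 3).congr (by decide))
      · change IsSupportedOn _ (2 : ZMod 5)
        exact ((((ha.pow 2).mul hc).ofNat_mul 3).congr (by decide)).add (((ha.mul (hD.pow 2)).ofNat_mul 3).congr (by decide))
      · change IsSupportedOn _ (3 : ZMod 5)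
        exact ((hD.pow 3).neg.congr (by decide)).sub (((ha.mul (hc.mul hD)).ofNat_mul 6).congr (by decide))
      · change IsSupportedOn _ (4 : ZMod 5)
        exact (((ha.mul (hc.pow 2)).ofNat_mul 3).congr (by decide)).add (((hc.mul (hD.pow 2)).ofNat_mul 3).congr (by decide))
  have h2' : 3 * a * (a * c + D ^ 2) = 0 := by
    rw [← h2]
    change _ = 3 * (a ^ 2 * c) + 3 * (a * D ^ 2)
    ring
  have ha0 : a ≠ 0 := by
    intro h0
    have := coeff_zero_residuePart (K := K) (ℓ := 5)
    rw [← hE, ← ha', h0, map_zero] at this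
    exact zero_ne_one this
  have h3 : (3 : K⟦X⟧) ≠ 0 := by
    intro h0
    have := congrArg (coeff 0) h0
    rw [← map_ofNat C 3] at this
    simp at this
  have := (mul_eq_zero.1 h2').resolve_left (mul_ne_zero h3 ha0)
  linear_combination this

/-- The modular equation of level `5`, before dividing by powers of `D`. -/
theorem exists_equation_five [CharZero K] {E D : K⟦X⟧} (hE : E = pentagonalSeries K)
    (hD : D = eulerShift K 5 (by norm_num) 1) : ∃ S : K⟦X⟧, IsSupportedOn S (0 : ZMod 5) ∧
    E ^ 5 + 5 * D * E ^ 4 + 15 * D ^ 2 * E ^ 3 + 25 * D ^ 3 * E ^ 2 + 25 * D ^ 4 * E = S := by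
  obtain ⟨a, c, ha, hc, h1, h2⟩ := exists_dissection_five (K := K)
  rw [← hE, ← hD] at h1
  rw [← hD] at h2
  have hD' : IsSupportedOn D (1 : ZMod 5) := by
    rw [hD]
    simpa using isSupportedOn_eulerShift (R := K) (ℓ := 5) (by norm_num) 1
  refine ⟨a ^ 5 + c ^ 5 - 11 * D ^ 5, (((ha.pow 5).congr (by decide)).add ((hc.pow 5).congr (by decide))).sub
    (((hD'.pow 5).ofNat_mul 11).congr (by decide)), ?_⟩
  rw [h1]
  have h3 : a ^ 5 + c ^ 5 = (a + c) ^ 5 - 5 * (a * c) * (a + c) ^ 3 + 5 * (a * c) ^ 2 * (a + c) := by ring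
  rw [h3, h2]
  ring

end Five

section Seven

variable {K : Type*} [Field K]

theorem residuePart_seven_two : residuePart (pentagonalSeries K) (2 : ZMod 7) =
    -eulerShift K 7 (by norm_num) 2 := by
  have := residuePart_pentagonalSeries_eq_neg (R := K) (ℓ := 7) (by norm_num) 2 (fun m ↦ 7 * m - 1)
    ?_ ?_ ?_
  · simpa using this
  · intro m
    have h1 := two_mul_natCast_pentagonal (7 * m - 1)
    have h2 := two_mul_natCast_pentagonal m
    zify
    linarith
  · intro k hk
    have h := two_mul_pentagonal_zmod 7 k
    rw [hk] at h
    have h' : ∀ x : ZMod 7, (2 : ZMod 7) * (2 : ℕ) = x * (3 * x - 1) → x = 6 := by decide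
    have h2 := h' _ h
    have h3 : ((-1 : ℤ) : ZMod 7) = ((k : ℤ) : ZMod 7) := by
      rw [h2]
      decide
    rw [ZMod.intCast_eq_intCast_iff_dvd_sub] at h3
    obtain ⟨m, hm⟩ := h3
    exact ⟨m, by push_cast at hm; linarith⟩
  · intro m
    rw [Int.negOnePow_sub, Int.negOnePow_one, Int.negOnePow_eq_iff _ _ |>.2 (?_ : Even (7 * m - m))]
    · simp
    · exact ⟨3 * m, by ring⟩

theorem residuePart_seven_eq_zero {c : ZMod 7} (hc : ∀ x : ZMod 7, 2 * c ≠ x * (3 * x - 1)) :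
    residuePart (pentagonalSeries K) c = 0 := by
  refine residuePart_pentagonalSeries_eq_zero fun k hk ↦ hc k ?_
  rw [← hk]
  exact two_mul_pentagonal_zmod 7 k

theorem exists_dissection_seven [CharZero K] {E D : K⟦X⟧} (hE : E = pentagonalSeries K)
    (hD' : D = eulerShift K 7 (by norm_num) 2) : ∃ a b c : K⟦X⟧,
    IsSupportedOn a (0 : ZMod 7) ∧ IsSupportedOn b (1 : ZMod 7) ∧ IsSupportedOn c (5 : ZMod 7) ∧
    IsSupportedOn D (2 : ZMod 7) ∧ coeff 0 a = 1 ∧ coeff 1 b = -1 ∧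
    E = a + b + c - D ∧ a * b ^ 2 - a ^ 2 * D + c * D ^ 2 = 0 ∧
    b * c ^ 2 - b ^ 2 * D + a * D ^ 2 = 0 ∧ a ^ 2 * c - c ^ 2 * D + b * D ^ 2 = 0 ∧
    a * b * c + D ^ 3 = 0 := by
  set a := residuePart E (0 : ZMod 7) with ha'
  set b := residuePart E (1 : ZMod 7) with hb'
  set c := residuePart E (5 : ZMod 7) with hc'
  have ha : IsSupportedOn a (0 : ZMod 7) := isSupportedOn_residuePart _ _
  have hb : IsSupportedOn b (1 : ZMod 7) := isSupportedOn_residuePart _ _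
  have hc : IsSupportedOn c (5 : ZMod 7) := isSupportedOn_residuePart _ _
  have hD : IsSupportedOn D (2 : ZMod 7) := by
    rw [hD']
    simpa using isSupportedOn_eulerShift (R := K) (ℓ := 7) (by norm_num) 2
  have hb1 : coeff 1 b = -1 := by
    have h := coeff_pentagonalSeries_pentagonal K 1
    rw [show pentagonal 1 = 1 from rfl] at h
    rw [hb', hE, residuePart, coeff_mk, if_pos (by simp), h]
    simp
  have hsum : E = a + b + c - D := by
    have h := sum_residuePart (ℓ := 7) E
    have h3 : residuePart E (3 : ZMod 7) = 0 := hE ▸ residuePart_seven_eq_zero (by decide)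
    have h4 : residuePart E (4 : ZMod 7) = 0 := hE ▸ residuePart_seven_eq_zero (by decide)
    have h6 : residuePart E (6 : ZMod 7) = 0 := hE ▸ residuePart_seven_eq_zero (by decide)
    have h2 : residuePart E (2 : ZMod 7) = -D := by rw [hE, hD', residuePart_seven_two]
    have h5 : ∑ x : ZMod 7, residuePart E x = residuePart E (0 : ZMod 7) +
      residuePart E (1 : ZMod 7) + residuePart E (2 : ZMod 7) + residuePart E (3 : ZMod 7) +
      residuePart E (4 : ZMod 7) + residuePart E (5 : ZMod 7) + residuePart E (6 : ZMod 7) :=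
      Fin.sum_univ_seven _
    rw [h5, h3, h4, h6, h2] at h
    rw [← h]
    ring
  let h : ZMod 7 → K⟦X⟧ := ![
    a ^ 3 + 3 * (b ^ 2 * c) - 6 * (a * c * D),
    c ^ 3 + 3 * (a ^ 2 * b) - 6 * (b * c * D),
    3 * (b ^ 2 * a) - 3 * (a ^ 2 * D) + 3 * (D ^ 2 * c),
    b ^ 3 + 3 * (c ^ 2 * a) - 6 * (a * b * D),
    3 * (c ^ 2 * b) - 3 * (b ^ 2 * D) + 3 * (D ^ 2 * a),
    3 * (a ^ 2 * c) - 3 * (c ^ 2 * D) + 3 * (D ^ 2 * b),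
    6 * (a * b * c) - D ^ 3]
  have hs : E ^ 3 = ∑ c, h c := by
    rw [hsum, show ∑ c, h c = h 0 + h 1 + h 2 + h 3 + h 4 + h 5 + h 6 from Fin.sum_univ_seven _]
    change _ = (a ^ 3 + 3 * (b ^ 2 * c) - 6 * (a * c * D)) +
      (c ^ 3 + 3 * (a ^ 2 * b) - 6 * (b * c * D)) +
      (3 * (b ^ 2 * a) - 3 * (a ^ 2 * D) + 3 * (D ^ 2 * c)) +
      (b ^ 3 + 3 * (c ^ 2 * a) - 6 * (a * b * D)) +
      (3 * (c ^ 2 * b) - 3 * (b ^ 2 * D) + 3 * (D ^ 2 * a)) +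
      (3 * (a ^ 2 * c) - 3 * (c ^ 2 * D) + 3 * (D ^ 2 * b)) + (6 * (a * b * c) - D ^ 3)
    ring
  have hh : ∀ x, IsSupportedOn (h x) x := by
    intro x
    fin_cases x
    · change IsSupportedOn _ (0 : ZMod 7)
      exact ((((ha.pow 3).congr (by decide)).add
          ((((hb.pow 2).mul hc).ofNat_mul 3).congr (by decide))).sub
          ((((ha.mul hc).mul hD).ofNat_mul 6).congr (by decide)))
    · change IsSupportedOn _ (1 : ZMod 7)
      exact ((((hc.pow 3).congr (by decide)).add
          ((((ha.pow 2).mul hb).ofNat_mul 3).congr (by decide))).sub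
          ((((hb.mul hc).mul hD).ofNat_mul 6).congr (by decide)))
    · change IsSupportedOn _ (2 : ZMod 7)
      exact ((((((hb.pow 2).mul ha).ofNat_mul 3).congr (by decide)).sub
          ((((ha.pow 2).mul hD).ofNat_mul 3).congr (by decide))).add
          ((((hD.pow 2).mul hc).ofNat_mul 3).congr (by decide)))
    · change IsSupportedOn _ (3 : ZMod 7)
      exact ((((hb.pow 3).congr (by decide)).add
          ((((hc.pow 2).mul ha).ofNat_mul 3).congr (by decide))).sub
          ((((ha.mul hb).mul hD).ofNat_mul 6).congr (by decide)))
    · change IsSupportedOn _ (4 : ZMod 7)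
      exact ((((((hc.pow 2).mul hb).ofNat_mul 3).congr (by decide)).sub
          ((((hb.pow 2).mul hD).ofNat_mul 3).congr (by decide))).add
          ((((hD.pow 2).mul ha).ofNat_mul 3).congr (by decide)))
    · change IsSupportedOn _ (5 : ZMod 7)
      exact ((((((ha.pow 2).mul hc).ofNat_mul 3).congr (by decide)).sub
          ((((hc.pow 2).mul hD).ofNat_mul 3).congr (by decide))).add
          ((((hD.pow 2).mul hb).ofNat_mul 3).congr (by decide)))
    · change IsSupportedOn _ (6 : ZMod 7)
      exact (((((ha.mul hb).mul hc).ofNat_mul 6).congr (by decide)).sub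
          ((hD.pow 3).congr (by decide)))
  have h2 : h 2 = 0 := eq_zero_of_sum_isSupportedOn hs hh
    (hE ▸ coeff_pentagonalSeries_pow_three_eq_zero_of_zmod (by decide))
  have h4 : h 4 = 0 := eq_zero_of_sum_isSupportedOn hs hh
    (hE ▸ coeff_pentagonalSeries_pow_three_eq_zero_of_zmod (by decide))
  have h5 : h 5 = 0 := eq_zero_of_sum_isSupportedOn hs hh
    (hE ▸ coeff_pentagonalSeries_pow_three_eq_zero_of_zmod (by decide))
  have hthree : (3 : K⟦X⟧) ≠ 0 := by
    intro h0
    have := congrArg (coeff 0) h0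
    rw [← map_ofNat C 3] at this
    simp at this
  have h2' : a * b ^ 2 - a ^ 2 * D + c * D ^ 2 = 0 := by
    have : 3 * (b ^ 2 * a) - 3 * (a ^ 2 * D) + 3 * (D ^ 2 * c) = 0 := h2
    refine (mul_eq_zero.1 (?_ : (3 : K⟦X⟧) * _ = 0)).resolve_left hthree
    linear_combination this
  have h4' : b * c ^ 2 - b ^ 2 * D + a * D ^ 2 = 0 := by
    have : 3 * (c ^ 2 * b) - 3 * (b ^ 2 * D) + 3 * (D ^ 2 * a) = 0 := h4
    refine (mul_eq_zero.1 (?_ : (3 : K⟦X⟧) * _ = 0)).resolve_left hthree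
    linear_combination this
  have h5' : a ^ 2 * c - c ^ 2 * D + b * D ^ 2 = 0 := by
    have : 3 * (a ^ 2 * c) - 3 * (c ^ 2 * D) + 3 * (D ^ 2 * b) = 0 := h5
    refine (mul_eq_zero.1 (?_ : (3 : K⟦X⟧) * _ = 0)).resolve_left hthree
    linear_combination this
  have hb0 : b ≠ 0 := by
    intro h0
    rw [h0, map_zero] at hb1
    exact neg_ne_zero.2 one_ne_zero hb1.symm
  refine ⟨a, b, c, ha, hb, hc, hD, by rw [ha', hE, coeff_zero_residuePart], hb1, hsum, h2', h4', h5', ?_⟩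
  refine (mul_eq_zero.1 (?_ : b * _ = 0)).resolve_left hb0
  linear_combination c * h2' + D * h5'

/-- The modular equation of level `7`, before dividing by powers of `D`. -/
theorem exists_equation_seven [CharZero K] {E D : K⟦X⟧} (hE : E = pentagonalSeries K)
    (hD' : D = eulerShift K 7 (by norm_num) 2) : ∃ V : K⟦X⟧, IsSupportedOn V (1 : ZMod 7) ∧
    coeff 1 V = 1 ∧
    E ^ 7 * D + 7 * E ^ 6 * D ^ 2 + 21 * E ^ 5 * D ^ 3 + 49 * E ^ 4 * D ^ 4 + 147 * E ^ 3 * D ^ 5 +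
      343 * E ^ 2 * D ^ 6 + 343 * E * D ^ 7 +
      V * (7 * E ^ 3 * D + 35 * E ^ 2 * D ^ 2 + 49 * E * D ^ 3) = V ^ 2 := by
  obtain ⟨a, b, c, ha, hb, hc, hD, ha0, hb1, hsum, h2, h4, h5, hp⟩ := exists_dissection_seven hE hD'
  refine ⟨-(a ^ 3 * b + b ^ 3 * c + c ^ 3 * a + 8 * D ^ 4), ?_, ?_, ?_⟩
  · exact (((((ha.pow 3).mul hb).congr (by decide)).add (((hb.pow 3).mul hc).congr (by decide))).add
      (((hc.pow 3).mul ha).congr (by decide))).add (((hD.pow 4).ofNat_mul 8).congr (by decide)) |>.neg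
  · have hb0 : coeff 0 b = 0 := hb 0 (by decide)
    have hc0 : coeff 0 c = 0 := hc 0 (by decide)
    have hD0 : coeff 0 D = 0 := hD 0 (by decide)
    rw [coeff_zero_eq_constantCoeff_apply] at ha0 hb0 hc0 hD0
    simp [coeff_one_mul, pow_succ, ha0, hb0, hc0, hD0, hb1]
  · rw [hsum]
    linear_combination
      (14 * c ^ 3 * D ^ 2 - 42 * b * c * D ^ 3 - 203 * a * b ^ 2 * c ^ 2 + 224 * a * b ^ 3 * D -
      7 * a ^ 2 * c ^ 2 * D - 7 * a ^ 4 * c - 70 * c * D ^ 4 - 217 * b ^ 3 * c ^ 2 + 224 * b ^ 4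
      * D - 14 * a * c ^ 4 + 7 * a * b * c ^ 2 * D - 14 * a * b ^ 2 * D ^ 2 - 14 * a ^ 2 * D ^ 3
      - 21 * a ^ 3 * b * c - 63 * b * c ^ 4 - 6 * b ^ 2 * c ^ 2 * D + 131 * b ^ 3 * D ^ 2 - 3 *
      a * c ^ 2 * D ^ 2 - 61 * a * b * D ^ 3 - 64 * a ^ 2 * b ^ 2 * c - 3 * a ^ 3 * c * D - 1 *
      a ^ 5 + 140 * b * c ^ 2 * D ^ 2 - 84 * b ^ 2 * D ^ 3 - 84 * a * b ^ 3 * c - 28 * a ^ 2 * c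
      ^ 3 + 56 * a ^ 2 * b * c * D - 84 * b * D ^ 4 - 112 * a * b * c ^ 3 + 140 * a * b ^ 2 * c
      * D - 28 * D ^ 5 - 196 * b ^ 2 * c ^ 3 + 217 * b ^ 3 * c * D - 7 * a * c ^ 3 * D + 35 * a
      * b * c * D ^ 2 - 21 * a ^ 3 * c ^ 2 + 35 * a ^ 3 * b * D - 56 * b * c ^ 3 * D + 140 * b ^
      2 * c * D ^ 2 - 56 * a * c * D ^ 3 - 84 * a ^ 2 * b * c ^ 2 + 112 * a ^ 2 * b ^ 2 * D) *
      h2 + (- 28 * D ^ 5 + 14 * b ^ 3 * c * D + 21 * a * c ^ 3 * D + 196 * a * b * c * D ^ 2 +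
      203 * a ^ 2 * b ^ 3 + 21 * b * c ^ 3 * D + 224 * b ^ 2 * c * D ^ 2 - 28 * a * c * D ^ 3 +
      217 * a * b ^ 4 + 14 * a ^ 2 * b * c ^ 2 + 64 * c ^ 3 * D ^ 2 + 70 * b * c * D ^ 3 - 1 * b
      ^ 5 + 61 * a * b ^ 2 * c ^ 2 + 192 * a * b ^ 3 * D - 2 * a ^ 4 * c - 84 * c * D ^ 4 + 84 *
      b ^ 4 * D + 84 * a * b * c ^ 2 * D + 28 * a ^ 3 * b * c + 28 * b ^ 2 * c ^ 2 * D + 56 * b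
      ^ 3 * D ^ 2 + 84 * a * c ^ 2 * D ^ 2 - 84 * a * b * D ^ 3 + 112 * a ^ 2 * b ^ 2 * c + 7 *
      c ^ 4 * D + 203 * b * c ^ 2 * D ^ 2 - 42 * b ^ 2 * D ^ 3 - 70 * a * D ^ 4 + 196 * a * b ^
      3 * c + 21 * a ^ 4 * b + 56 * c ^ 2 * D ^ 3 - 84 * b * D ^ 4 + 168 * a * b ^ 2 * c * D +
      84 * a ^ 3 * b ^ 2) * h4 + (- 70 * b * D ^ 4 + 7 * a ^ 3 * b ^ 2 - 28 * D ^ 5 + 21 * a ^ 2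
      * b ^ 3 - 1 * c ^ 5 + 62 * a * b ^ 4 + 84 * b ^ 5 + 56 * b ^ 4 * D - 28 * b ^ 3 * D ^ 2 -
      84 * b ^ 2 * D ^ 3) * h5 + (- 9 * D ^ 5) * hp

end Seven

section Norm

variable {K : Type*} [Field K] {ℓ : ℕ}

theorem prod_one_sub_primitiveRoot_pow_mul {R : Type*} [CommRing R] [IsDomain R] {ζ : R}
    (hℓ : 0 < ℓ) (hζ : IsPrimitiveRoot ζ ℓ) (y : R) :
    ∏ i ∈ range ℓ, (1 - ζ ^ i * y) = 1 - y ^ ℓ := by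
  classical
  have h := hζ.pow_sub_pow_eq_prod_sub_mul 1 y hℓ
  rw [one_pow] at h
  rw [h, Polynomial.nthRootsFinset, hζ.nthRoots_eq (one_pow ℓ)]
  have h2 : ((Multiset.range ℓ).map (ζ ^ · * 1)).toFinset = (range ℓ).image (ζ ^ ·) := by
    ext x
    simp
  rw [h2, prod_image]
  intro i hi j hj hij
  exact hζ.pow_inj (mem_range.1 hi) (mem_range.1 hj) hij

theorem prod_one_sub_rescale {ω : K} (hℓ : ℓ.Prime) (hω : IsPrimitiveRoot ω ℓ) (m : ℕ) :
    ∏ i ∈ range ℓ, (1 - rescale (ω ^ i) X ^ m : K⟦X⟧) =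
      if ℓ ∣ m then (1 - X ^ m) ^ ℓ else 1 - X ^ (ℓ * m) := by
  have h1 : ∀ i, (rescale (ω ^ i) X ^ m : K⟦X⟧) = C (ω ^ m) ^ i * X ^ m := by
    intro i
    rw [rescale_X, mul_pow, ← map_pow, ← map_pow, ← pow_mul, ← pow_mul, mul_comm m i]
  simp_rw [h1]
  split_ifs with h
  · obtain ⟨k, rfl⟩ := h
    simp [pow_mul, hω.pow_eq_one]
  · rw [prod_one_sub_primitiveRoot_pow_mul hℓ.pos, ← pow_mul, mul_comm m]
    exact (hω.pow_of_coprime m ((hℓ.coprime_iff_not_dvd.2 h).symm)).map_of_injective C_injective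

open scoped PowerSeries.WithPiTopology in
theorem prod_rescale_pentagonalSeries {ω : K} (hℓ : ℓ.Prime) (hω : IsPrimitiveRoot ω ℓ) :
    (∏ i ∈ range ℓ, rescale (ω ^ i) (pentagonalSeries K)) *
      expand ℓ hℓ.ne_zero (expand ℓ hℓ.ne_zero (pentagonalSeries K)) =
      expand ℓ hℓ.ne_zero (pentagonalSeries K) ^ (ℓ + 1) := by
  let _ : TopologicalSpace K := ⊥
  have _ : DiscreteTopology K := ⟨rfl⟩
  have hE := WithPiTopology.hasProd_one_sub_X_pow K
  have hr : ∀ a : K, Continuous (rescale a) := by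
    intro a
    rw [continuous_iff_continuousAt]
    intro f
    rw [ContinuousAt, WithPiTopology.tendsto_iff_coeff_tendsto]
    intro d
    simp_rw [coeff_rescale]
    exact ((WithPiTopology.continuous_coeff K d).tendsto f).const_mul _
  have he : Continuous (expand ℓ hℓ.ne_zero : K⟦X⟧ →ₐ[K] K⟦X⟧) := by
    rw [continuous_iff_continuousAt]
    intro f
    rw [ContinuousAt, WithPiTopology.tendsto_iff_coeff_tendsto]
    intro d
    simp_rw [coeff_expand]
    split_ifs with h
    · exact (WithPiTopology.continuous_coeff K _).tendsto f
    · exact tendsto_const_nhds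
  have hE1 : HasProd (fun n ↦ 1 - X ^ (ℓ * (n + 1)))
      (expand ℓ hℓ.ne_zero (pentagonalSeries K)) := by
    convert hE.map (expand ℓ hℓ.ne_zero) he using 2 with n
    simp [pow_mul]
  have hE2 : HasProd (fun n ↦ 1 - X ^ (ℓ * (ℓ * (n + 1))))
      (expand ℓ hℓ.ne_zero (expand ℓ hℓ.ne_zero (pentagonalSeries K))) := by
    convert hE1.map (expand ℓ hℓ.ne_zero) he using 2 with n
    simp [pow_mul]
  have hinj : Function.Injective fun n ↦ ℓ * (n + 1) - 1 := by
    intro a b hab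
    have h1 := Nat.mul_pos hℓ.pos a.succ_pos
    have h2 := Nat.mul_pos hℓ.pos b.succ_pos
    have : ℓ * (a + 1) = ℓ * (b + 1) := by simp only at hab; grind
    exact Nat.succ_injective (Nat.eq_of_mul_eq_mul_left hℓ.pos this)
  have hrange : ∀ x, x ∉ Set.range (fun n ↦ ℓ * (n + 1) - 1) → ¬ ℓ ∣ x + 1 := by
    rintro x hx ⟨k, hk⟩
    refine hx ⟨k - 1, ?_⟩
    have : k ≠ 0 := by rintro rfl; simp at hk
    simp only
    rw [Nat.sub_add_cancel (Nat.one_le_iff_ne_zero.2 this), ← hk, Nat.add_sub_cancel]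
  have hcancel : ∀ n, ℓ * (n + 1) - 1 + 1 = ℓ * (n + 1) := fun n ↦
    Nat.sub_add_cancel (Nat.mul_pos hℓ.pos n.succ_pos)
  have h1 : HasProd (fun m ↦ if ℓ ∣ m + 1 then 1 - X ^ (ℓ * (m + 1)) else 1)
      (expand ℓ hℓ.ne_zero (expand ℓ hℓ.ne_zero (pentagonalSeries K))) := by
    rw [← hinj.hasProd_iff fun x hx ↦ if_neg (hrange x hx)]
    convert hE2 using 2 with n
    simp only [Function.comp, hcancel]
    rw [if_pos (dvd_mul_right _ _)]
  have h2 : HasProd (fun m ↦ if ℓ ∣ m + 1 then (1 - X ^ (m + 1)) ^ ℓ else 1)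
      (expand ℓ hℓ.ne_zero (pentagonalSeries K) ^ ℓ) := by
    rw [← hinj.hasProd_iff fun x hx ↦ if_neg (hrange x hx)]
    convert hE1.pow ℓ using 2 with n
    simp only [Function.comp, hcancel]
    rw [if_pos (dvd_mul_right _ _)]
  have h3 : HasProd (fun m ↦ ∏ i ∈ range ℓ, (1 - rescale (ω ^ i) X ^ (m + 1) : K⟦X⟧))
      (∏ i ∈ range ℓ, rescale (ω ^ i) (pentagonalSeries K)) := by
    refine hasProd_prod fun i _ ↦ ?_
    convert hE.map (rescale (ω ^ i)) (hr _) using 2 with n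
    simp
  refine (h3.mul h1).unique ?_
  rw [pow_succ]
  convert h2.mul hE1 using 2 with m
  rw [prod_one_sub_rescale hℓ hω]
  split_ifs <;> simp

end Norm

section Roots

open Polynomial in
theorem eq_prod_of_monic_of_injOn {R : Type*} [CommRing R] [IsDomain R] {F : R[X]} {n : ℕ}
    (hF : F.Monic) (hn : F.natDegree = n) {r : ℕ → R} (hr : Set.InjOn r (range n))
    (h0 : ∀ i < n, F.eval (r i) = 0) : F = ∏ i ∈ range n, (Polynomial.X - Polynomial.C (r i)) := by
  have hm : (∏ i ∈ range n, (Polynomial.X - Polynomial.C (r i))).Monic := monic_prod_of_monic _ _ fun i _ ↦ Polynomial.monic_X_sub_C _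
  have hd : (∏ i ∈ range n, (Polynomial.X - Polynomial.C (r i))).natDegree = n := by
    rw [natDegree_prod_of_monic _ _ fun i _ ↦ Polynomial.monic_X_sub_C _]
    simp
  refine Polynomial.eq_of_degree_sub_lt_of_eval_index_eq (range n) hr ?_ ?_
  · have h := degree_sub_lt_left (p := F) (q := ∏ i ∈ range n, (Polynomial.X - Polynomial.C (r i))) ?_ hF.ne_zero ?_
    · rw [degree_eq_natDegree hF.ne_zero, hn] at h
      rwa [card_range]
    · rw [degree_eq_natDegree hF.ne_zero, degree_eq_natDegree hm.ne_zero, hn, hd]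
    · rw [hF.leadingCoeff, hm.leadingCoeff]
  · intro i hi
    rw [h0 i (mem_range.1 hi), eval_prod, eq_comm]
    exact prod_eq_zero hi (by simp)

open Polynomial in
theorem prod_roots_eq {R : Type*} [CommRing R] {F : R[X]} {n : ℕ} {r : ℕ → R}
    (hF : F = ∏ i ∈ range n, (Polynomial.X - Polynomial.C (r i))) : ∏ i ∈ range n, r i = (-1) ^ n * F.coeff 0 := by
  rw [hF, coeff_zero_eq_eval_zero, eval_prod]
  simp only [eval_sub, Polynomial.eval_X, Polynomial.eval_C, zero_sub]
  rw [prod_neg, card_range, ← mul_assoc, ← mul_pow]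
  simp

/-- Newton's identities for the roots of a polynomial. -/
theorem sum_pow_roots_eq {R : Type*} [CommRing R] {F : Polynomial R} {n : ℕ} {r : ℕ → R}
    (hF : F = ∏ i ∈ range n, (Polynomial.X - Polynomial.C (r i))) {k : ℕ} (hk : 0 < k)
    (hkn : k ≤ n) : ∑ i ∈ range n, r i ^ k = -(k * F.coeff (n - k)) -
      ∑ a ∈ range (k - 1), F.coeff (n - (a + 1)) * ∑ i ∈ range n, r i ^ (k - (a + 1)) := by
  have h := congrArg (MvPolynomial.aeval fun i : Fin n ↦ r i)
    (MvPolynomial.psum_eq_mul_esymm_sub_sum (Fin n) R k hk)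
  have hp : ∀ m, MvPolynomial.aeval (fun i : Fin n ↦ r i) (MvPolynomial.psum (Fin n) R m) =
      ∑ i ∈ range n, r i ^ m := by
    intro m
    simp [MvPolynomial.psum, Finset.sum_range]
  have he : ∀ m ≤ n, (-1) ^ m * MvPolynomial.aeval (fun i : Fin n ↦ r i) (MvPolynomial.esymm (Fin n) R m) =
      F.coeff (n - m) := by
    intro m hm
    have h1 := Multiset.prod_X_sub_C_coeff ((univ : Finset (Fin n)).val.map fun i : Fin n ↦ r i)
      (k := n - m) (by simp)
    rw [Multiset.map_map, Multiset.card_map, card_val, card_univ, Fintype.card_fin,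
      Nat.sub_sub_self hm, ← MvPolynomial.aeval_esymm_eq_multiset_esymm (Fin n) R] at h1
    rw [← h1, hF, Finset.prod_range]
    rfl
  rw [map_sub, hp, map_sum, map_mul, map_mul] at h
  rw [h]
  congr 1
  · simp only [map_pow, map_neg, map_one, map_natCast]
    rw [← he k hkn]
    ring
  · refine Finset.sum_nbij' (fun p ↦ p.1 - 1) (fun a ↦ (a + 1, k - (a + 1))) ?_ ?_ ?_ ?_ ?_
    · intro p hp'
      simp only [mem_filter, HasAntidiagonal.mem_antidiagonal, Set.mem_Ioo, mem_range] at hp' ⊢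
      omega
    · intro a ha
      simp only [mem_filter, HasAntidiagonal.mem_antidiagonal, Set.mem_Ioo, mem_range] at ha ⊢
      omega
    · intro p hp'
      simp only [mem_filter, HasAntidiagonal.mem_antidiagonal, Set.mem_Ioo] at hp'
      ext
      · exact Nat.sub_add_cancel hp'.2.1
      · simp only
        omega
    · intro a _
      exact Nat.add_sub_cancel a 1
    · intro p hp'
      simp only [mem_filter, HasAntidiagonal.mem_antidiagonal, Set.mem_Ioo] at hp'
      rw [Nat.sub_add_cancel hp'.2.1, ← he p.1 (by omega), map_mul, map_mul, hp,
        show k - p.1 = p.2 by omega]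
      simp

end Roots

section AtkinOperator

variable {K : Type*} [Field K] {ℓ : ℕ}

/-- Atkin's operator `U`, which sends `∑ aₙ Xⁿ` to `∑ a_{ℓ n} Xⁿ`. -/
noncomputable def atkinU (K : Type*) [Field K] (ℓ : ℕ) : K⟦X⟧ →ₗ[K] K⟦X⟧ where
  toFun f := PowerSeries.mk fun n ↦ coeff (ℓ * n) f
  map_add' f g := by ext; simp
  map_smul' a f := by ext; simp

theorem coeff_atkinU (f : K⟦X⟧) (n : ℕ) : coeff n (atkinU K ℓ f) = coeff (ℓ * n) f := by
  simp [atkinU]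

theorem expand_injective (hℓ : ℓ ≠ 0) : Function.Injective (expand ℓ hℓ : K⟦X⟧ →ₐ[K] K⟦X⟧) := by
  intro f g h
  ext n
  rw [← coeff_expand_mul ℓ hℓ f, h, coeff_expand_mul]

theorem rescale_expand {ω : K} (hω : ω ^ ℓ = 1) (hℓ : ℓ ≠ 0) (i : ℕ) (f : K⟦X⟧) :
    rescale (ω ^ i) (expand ℓ hℓ f) = expand ℓ hℓ f := by
  ext n
  rw [coeff_rescale, coeff_expand]
  split_ifs with h
  · obtain ⟨k, rfl⟩ := h
    rw [← pow_mul, mul_left_comm, pow_mul, hω, one_pow, one_mul]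
  · simp

theorem sum_rescale {ω : K} (hℓ : ℓ.Prime) (hω : IsPrimitiveRoot ω ℓ) (f : K⟦X⟧) :
    ∑ i ∈ range ℓ, rescale (ω ^ i) f = (ℓ : K⟦X⟧) * expand ℓ hℓ.ne_zero (atkinU K ℓ f) := by
  ext n
  rw [map_sum, ← nsmul_eq_mul, map_nsmul, coeff_expand]
  simp_rw [coeff_rescale]
  rw [← sum_mul]
  split_ifs with h
  · obtain ⟨k, rfl⟩ := h
    rw [Nat.mul_div_cancel_left _ hℓ.pos, coeff_atkinU]
    have : ∀ i, (ω ^ i) ^ (ℓ * k) = 1 := fun i ↦ by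
      rw [← pow_mul, mul_left_comm, pow_mul, hω.pow_eq_one, one_pow]
    simp [this]
  · have h1 : ∑ i ∈ range ℓ, (ω ^ i) ^ n = 0 := by
      simp_rw [← pow_mul, mul_comm _ n, pow_mul]
      exact (hω.pow_of_coprime n (hℓ.coprime_iff_not_dvd.2 h).symm).geom_sum_eq_zero hℓ.one_lt
    rw [h1, zero_mul, smul_zero]

theorem natCast_ne_zero [CharZero K] (hℓ : ℓ ≠ 0) : (ℓ : K⟦X⟧) ≠ 0 := by
  intro h
  have := congrArg (coeff 0) h
  rw [← map_natCast C] at this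
  simp [hℓ] at this

theorem atkinU_mul_expand [CharZero K] {ω : K} (hℓ : ℓ.Prime) (hω : IsPrimitiveRoot ω ℓ) (f g : K⟦X⟧) :
    atkinU K ℓ (f * expand ℓ hℓ.ne_zero g) = atkinU K ℓ f * g := by
  apply expand_injective hℓ.ne_zero
  apply mul_left_cancel₀ (natCast_ne_zero (K := K) hℓ.ne_zero)
  rw [← sum_rescale hℓ hω, map_mul, ← mul_assoc, ← sum_rescale hℓ hω, sum_mul]
  refine sum_congr rfl fun i _ ↦ ?_
  rw [map_mul, rescale_expand hω.pow_eq_one]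

theorem IsSupportedOn.rescale {ω : K} (hω : ω ^ ℓ = 1) {f : K⟦X⟧} {c : ℕ}
    (hf : IsSupportedOn f (c : ZMod ℓ)) (i : ℕ) :
    PowerSeries.rescale (ω ^ i) f = C (ω ^ i) ^ c * f := by
  ext n
  rw [coeff_rescale, ← map_pow, coeff_C_mul]
  by_cases hn : (n : ZMod ℓ) = c
  · rw [ZMod.natCast_eq_natCast_iff] at hn
    congr 1
    rw [← pow_mul, ← pow_mul, mul_comm, mul_comm i, pow_mul, pow_mul]
    congr 1
    rw [pow_eq_pow_mod n hω, pow_eq_pow_mod c hω, hn]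
  · rw [hf n hn, mul_zero, mul_zero]

theorem prod_C_pow {ω : K} (hω : ω ^ ℓ = 1) (hℓ : Odd ℓ) (c : ℕ) :
    ∏ i ∈ range ℓ, (C (ω ^ i) ^ c : K⟦X⟧) = 1 := by
  rw [prod_pow, ← map_prod, prod_pow_eq_pow_sum, sum_range_id]
  obtain ⟨k, rfl⟩ := hℓ
  rw [show (2 * k + 1) * (2 * k + 1 - 1) / 2 = (2 * k + 1) * k by
    rw [Nat.add_sub_cancel, mul_left_comm, Nat.mul_div_cancel_left _ two_pos], pow_mul, hω]
  simp

open Polynomial in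
/-- The traces of powers of a power series whose conjugates are the roots of `F`. -/
theorem natCast_mul_expand_atkinU_pow {ω : K} (hℓ : ℓ.Prime) (hω : IsPrimitiveRoot ω ℓ)
    {f : K⟦X⟧} {F : K⟦X⟧[X]} (hF : F.Monic) (hdeg : F.natDegree = ℓ)
    {d : ℕ} (hd : d.Coprime ℓ) (hf : PowerSeries.coeff d f = 1)
    (h0 : ∀ i, F.eval (rescale (ω ^ i) f) = 0) {k : ℕ} (hk : 0 < k) (hkn : k ≤ ℓ) :
    (ℓ : K⟦X⟧) * PowerSeries.expand ℓ hℓ.ne_zero (atkinU K ℓ (f ^ k)) = -(k * F.coeff (ℓ - k)) -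
      ∑ a ∈ range (k - 1), F.coeff (ℓ - (a + 1)) *
        ((ℓ : K⟦X⟧) * PowerSeries.expand ℓ hℓ.ne_zero (atkinU K ℓ (f ^ (k - (a + 1))))) := by
  have hinj : Set.InjOn (fun i ↦ rescale (ω ^ i) f) (range ℓ) := by
    intro i hi j hj hij
    have h := congrArg (PowerSeries.coeff d) hij
    simp only [coeff_rescale, hf, mul_one] at h
    rw [← pow_mul, ← pow_mul, mul_comm, mul_comm j, pow_mul, pow_mul] at h
    exact (hω.pow_of_coprime d hd).pow_inj (by simpa using hi) (by simpa using hj) h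
  have hprod := eq_prod_of_monic_of_injOn hF hdeg hinj fun i _ ↦ h0 i
  have := sum_pow_roots_eq hprod hk hkn
  simp_rw [← map_pow, sum_rescale hℓ hω] at this
  exact this

end AtkinOperator

section ModularEquation

variable {K : Type*} [Field K]

theorem constantCoeff_pentagonalSeries : constantCoeff (pentagonalSeries K) = 1 := by
  have h := coeff_pentagonalSeries_pentagonal K 0
  rw [show pentagonal 0 = 0 from rfl] at h
  rw [← coeff_zero_eq_constantCoeff_apply, h]
  simp

theorem coeff_eulerShift_mul {ℓ d : ℕ} (hℓ : ℓ ≠ 0) {P : K⟦X⟧} (hP : constantCoeff P = 1) :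
    coeff d (eulerShift K ℓ hℓ d * P) = 1 := by
  rw [eulerShift, mul_assoc]
  have := coeff_X_pow_mul (expand ℓ hℓ (expand ℓ hℓ (pentagonalSeries K)) * P) d 0
  rw [zero_add] at this
  rw [this, coeff_zero_eq_constantCoeff_apply, map_mul, constantCoeff_expand,
    constantCoeff_expand, hP, constantCoeff_pentagonalSeries, mul_one]

theorem C_pow_eq_one {ω : K} {ℓ : ℕ} (hω : ω ^ ℓ = 1) (i : ℕ) : (C (ω ^ i) ^ ℓ : K⟦X⟧) = 1 := by
  rw [← map_pow, ← pow_mul, mul_comm, pow_mul, hω, one_pow, map_one]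

theorem injOn_of_coeff {ω : K} {ℓ c d : ℕ} (hω : IsPrimitiveRoot ω ℓ) (hc : c.Coprime ℓ)
    {f : ℕ → K⟦X⟧} (hf : ∀ i, coeff d (f i) = 1) :
    Set.InjOn (fun i ↦ C (ω ^ i) ^ c * f i) (range ℓ) := by
  intro i hi j hj hij
  have h := congrArg (coeff d) hij
  simp only [← map_pow, coeff_C_mul, hf, mul_one] at h
  rw [← pow_mul, ← pow_mul, mul_comm, mul_comm j, pow_mul, pow_mul] at h
  exact (hω.pow_of_coprime c hc).pow_inj (by simpa using hi) (by simpa using hj) h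

theorem norm_equation_five [CharZero K] {ω : K} (hω : IsPrimitiveRoot ω 5) {E D : K⟦X⟧}
    (hE : E = pentagonalSeries K) (hD : D = eulerShift K 5 (by norm_num) 1) :
    (E ^ 5 + 5 * D * E ^ 4 + 15 * D ^ 2 * E ^ 3 + 25 * D ^ 3 * E ^ 2 + 25 * D ^ 4 * E) *
      expand 5 (by norm_num) (expand 5 (by norm_num) E) = expand 5 (by norm_num) E ^ 6 := by
  obtain ⟨S, hS, hEq⟩ := exists_equation_five hE hD
  rw [hEq]
  have hω1 := hω.pow_eq_one
  let F : Polynomial K⟦X⟧ := .X ^ 5 + .C (5 * D) * .X ^ 4 + .C (15 * D ^ 2) * .X ^ 3 +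
    .C (25 * D ^ 3) * .X ^ 2 + .C (25 * D ^ 4) * .X - .C S
  have hdeg : F.natDegree = 5 := by
    simp only [F]
    compute_degree!
  have hm : F.Monic := by
    simp only [F]
    monicity!
  have hroot : ∀ i < 5, F.eval (C (ω ^ i) ^ 4 * rescale (ω ^ i) E) = 0 := by
    intro i _
    have h1 := congrArg (rescale (ω ^ i)) hEq
    have hz := C_pow_eq_one hω1 i
    have hDi : rescale (ω ^ i) D = C (ω ^ i) ^ 1 * D := by
      rw [hD]
      exact (isSupportedOn_eulerShift (by norm_num) 1).rescale hω1 i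
    have hSi : rescale (ω ^ i) S = C (ω ^ i) ^ 0 * S :=
      IsSupportedOn.rescale hω1 (c := 0) (by simpa using hS) i
    simp only [map_add, map_mul, map_pow, map_ofNat] at h1
    rw [hDi, hSi] at h1
    simp only [F, Polynomial.eval_add, Polynomial.eval_sub, Polynomial.eval_mul,
      Polynomial.eval_pow, Polynomial.eval_C, Polynomial.eval_X]
    generalize rescale (ω ^ i) E = e at *
    generalize C (ω ^ i) = z at *
    linear_combination h1 + (e ^ 5 * (z ^ 15 + z ^ 10 + z ^ 5 + 1) +
      5 * D * e ^ 4 * z * (z ^ 10 + z ^ 5 + 1) + 15 * D ^ 2 * e ^ 3 * z ^ 2 * (z ^ 5 + 1) +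
      25 * D ^ 3 * e ^ 2 * z ^ 3) * hz
  have hinj : Set.InjOn (fun i ↦ C (ω ^ i) ^ 4 * rescale (ω ^ i) E) (range 5) :=
    injOn_of_coeff (d := 0) hω (by decide) fun i ↦ by
      rw [coeff_rescale, hE, coeff_zero_eq_constantCoeff_apply, constantCoeff_pentagonalSeries,
        pow_zero, one_mul]
  have h := prod_roots_eq (eq_prod_of_monic_of_injOn hm hdeg hinj hroot)
  rw [prod_mul_distrib, prod_C_pow hω1 (by decide), one_mul] at h
  have h2 := prod_rescale_pentagonalSeries Nat.prime_five hω
  rw [← hE, h] at h2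
  have h3 : F.coeff 0 = -S := by simp [F, Polynomial.coeff_zero_eq_eval_zero]
  rw [← h2, h3]
  ring

theorem norm_equation_seven [CharZero K] {ω : K} (hω : IsPrimitiveRoot ω 7) {E D V : K⟦X⟧}
    (hE : E = pentagonalSeries K) (hD : D = eulerShift K 7 (by norm_num) 2)
    (hV : V = X * expand 7 (by norm_num) E ^ 4) :
    E ^ 7 * D + 7 * E ^ 6 * D ^ 2 + 21 * E ^ 5 * D ^ 3 + 49 * E ^ 4 * D ^ 4 + 147 * E ^ 3 * D ^ 5 +
      343 * E ^ 2 * D ^ 6 + 343 * E * D ^ 7 +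
      V * (7 * E ^ 3 * D + 35 * E ^ 2 * D ^ 2 + 49 * E * D ^ 3) = V ^ 2 := by
  obtain ⟨W, hW, hW1, hEq⟩ := exists_equation_seven hE hD
  have hE0 : constantCoeff E = 1 := by rw [hE, constantCoeff_pentagonalSeries]
  suffices W = V by rwa [this] at hEq
  have hω1 := hω.pow_eq_one
  have hD0 : D ≠ 0 := by
    intro h
    have := coeff_eulerShift_mul (K := K) (ℓ := 7) (d := 2) (by norm_num) (map_one constantCoeff)
    rw [← hD, h] at this
    simp at this
  let F : Polynomial K⟦X⟧ := .X ^ 7 + .C (7 * D ^ 2) * .X ^ 6 + .C (21 * D ^ 4) * .X ^ 5 +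
    .C (49 * D ^ 6) * .X ^ 4 + .C (147 * D ^ 8) * .X ^ 3 + .C (343 * D ^ 10) * .X ^ 2 +
    .C (343 * D ^ 12) * .X + .C W * (.C (7 * D ^ 4) * .X ^ 3 + .C (35 * D ^ 6) * .X ^ 2 +
    .C (49 * D ^ 8) * .X) - .C (W ^ 2 * D ^ 6)
  have hdeg : F.natDegree = 7 := by
    simp only [F]
    compute_degree!
  have hm : F.Monic := by
    simp only [F]
    monicity!
  have hroot : ∀ i < 7, F.eval (C (ω ^ i) ^ 5 * (D * rescale (ω ^ i) E)) = 0 := by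
    intro i _
    have h1 := congrArg (rescale (ω ^ i)) hEq
    have hz := C_pow_eq_one hω1 i
    have hDi : rescale (ω ^ i) D = C (ω ^ i) ^ 2 * D := by
      rw [hD]
      exact (isSupportedOn_eulerShift (by norm_num) 2).rescale hω1 i
    have hWi : rescale (ω ^ i) W = C (ω ^ i) ^ 1 * W :=
      IsSupportedOn.rescale hω1 (c := 1) (by simpa using hW) i
    simp only [map_add, map_mul, map_pow, map_ofNat] at h1
    rw [hDi, hWi] at h1
    simp only [F, Polynomial.eval_add, Polynomial.eval_sub, Polynomial.eval_mul,
      Polynomial.eval_pow, Polynomial.eval_C, Polynomial.eval_X]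
    generalize rescale (ω ^ i) E = e at *
    generalize C (ω ^ i) = z at *
    linear_combination z ^ 5 * D ^ 6 * h1 + (
      e ^ 7 * D ^ 7 * z ^ 7 * (1 + z ^ 7 + z ^ 14 + z ^ 21) +
      7 * e ^ 6 * D ^ 8 * z ^ 9 * (1 + z ^ 7 + z ^ 14) +
      21 * e ^ 5 * D ^ 9 * z ^ 11 * (1 + z ^ 7) + 49 * e ^ 4 * D ^ 10 * z ^ 13 -
      343 * e ^ 2 * D ^ 12 * z ^ 10 - 343 * e * D ^ 13 * z ^ 5 * (1 + z ^ 7) +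
      W * (7 * e ^ 3 * D ^ 7 * z ^ 8 - 49 * e * D ^ 9 * z ^ 5) + W ^ 2 * D ^ 6) * hz
  have hinj : Set.InjOn (fun i ↦ C (ω ^ i) ^ 5 * (D * rescale (ω ^ i) E)) (range 7) :=
    injOn_of_coeff (d := 2) hω (by decide) fun i ↦ by
      rw [hD]
      refine coeff_eulerShift_mul (by norm_num) ?_
      rw [← coeff_zero_eq_constantCoeff_apply, coeff_rescale, coeff_zero_eq_constantCoeff_apply,
        hE0, pow_zero, one_mul]
  have h := prod_roots_eq (eq_prod_of_monic_of_injOn hm hdeg hinj hroot)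
  rw [prod_mul_distrib, prod_C_pow hω1 (by decide), one_mul, prod_mul_distrib, prod_const,
    card_range] at h
  have h2 := prod_rescale_pentagonalSeries Nat.prime_seven hω
  rw [← hE] at h2
  have h3 : F.coeff 0 = -(W ^ 2 * D ^ 6) := by simp [F, Polynomial.coeff_zero_eq_eval_zero]
  rw [h3] at h
  have h4 : D * ∏ i ∈ range 7, rescale (ω ^ i) E = W ^ 2 := by
    apply mul_left_cancel₀ (pow_ne_zero 6 hD0)
    linear_combination h
  have h5 : W ^ 2 = V ^ 2 := by
    rw [← h4, hV, hD, eulerShift, ← hE]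
    linear_combination X ^ 2 * h2
  have hV1 : coeff 1 V = 1 := by
    rw [hV]
    have := coeff_succ_X_mul 0 (expand 7 (by norm_num) E ^ 4)
    rw [zero_add] at this
    rw [this, coeff_zero_eq_constantCoeff_apply, map_pow, constantCoeff_expand, hE0, one_pow]
  rcases sq_eq_sq_iff_eq_or_eq_neg.1 h5 with h6 | h6
  · exact h6
  · have := congrArg (coeff 1) h6
    rw [map_neg, hW1, hV1] at this
    exact absurd this (by norm_num)

end ModularEquation

section Valuation

/-- A bound on the `ℓ`-adic valuations and on the order of an integer polynomial, of slope `ℓ / s`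
and weight `k`. -/
def IsAdmissible (ℓ e s k : ℕ) (c : Polynomial ℤ) : Prop :=
  ∀ j, (ℓ * j < e * k → c.coeff j = 0) ∧ (ℓ : ℤ) ^ ((ℓ * j - e * k - 1) / s) ∣ c.coeff j

/-- A stronger variant of `IsAdmissible`, so that multiplication by such a polynomial shifts the
weight. -/
def IsStronglyAdmissible (ℓ e s k : ℕ) (c : Polynomial ℤ) : Prop :=
  ∀ j, (ℓ * j < e * k → c.coeff j = 0) ∧ ∃ v, ℓ * j ≤ e * k + s * v ∧ (ℓ : ℤ) ^ v ∣ c.coeff j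

variable {ℓ e s k m : ℕ} {c d : Polynomial ℤ}

theorem IsAdmissible.zero : IsAdmissible ℓ e s k 0 := fun j ↦ by simp

theorem IsAdmissible.add (hc : IsAdmissible ℓ e s k c) (hd : IsAdmissible ℓ e s k d) :
    IsAdmissible ℓ e s k (c + d) := fun j ↦ by
  rw [Polynomial.coeff_add]
  exact ⟨fun h ↦ by rw [(hc j).1 h, (hd j).1 h, add_zero], dvd_add (hc j).2 (hd j).2⟩

theorem IsAdmissible.sum {ι : Type*} {S : Finset ι} {f : ι → Polynomial ℤ}
    (hf : ∀ i ∈ S, IsAdmissible ℓ e s k (f i)) : IsAdmissible ℓ e s k (∑ i ∈ S, f i) :=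
  Finset.sum_induction _ (IsAdmissible ℓ e s k) (fun _ _ ↦ IsAdmissible.add) IsAdmissible.zero hf

theorem IsAdmissible.monomial {N : ℤ} {i : ℕ} (h1 : N = 0 ∨ e * k ≤ ℓ * i)
    (h2 : (ℓ : ℤ) ^ ((ℓ * i - e * k - 1) / s) ∣ N) :
    IsAdmissible ℓ e s k (Polynomial.C N * Polynomial.X ^ i) := fun j ↦ by
  rw [Polynomial.coeff_C_mul_X_pow]
  split_ifs with h
  · subst h
    exact ⟨fun h ↦ h1.resolve_right (by omega), h2⟩
  · simp

theorem IsStronglyAdmissible.monomial {N : ℤ} {i : ℕ} (v : ℕ) (h1 : N = 0 ∨ e * k ≤ ℓ * i)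
    (h2 : N = 0 ∨ ℓ * i ≤ e * k + s * v) (h3 : (ℓ : ℤ) ^ v ∣ N) (hs : 0 < s) :
    IsStronglyAdmissible ℓ e s k (Polynomial.C N * Polynomial.X ^ i) := fun j ↦ by
  have h4 : ∃ w, ℓ * j ≤ e * k + s * w := ⟨ℓ * j, (Nat.le_mul_of_pos_left _ hs).trans (Nat.le_add_left _ _)⟩
  rw [Polynomial.coeff_C_mul_X_pow]
  split_ifs with h
  · subst h
    refine ⟨fun h ↦ h1.resolve_right (by omega), ?_⟩
    rcases h2 with h2 | h2
    · rw [h2]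
      exact h4.imp fun w hw ↦ ⟨hw, dvd_zero _⟩
    · exact ⟨v, h2, h3⟩
  · exact ⟨fun _ ↦ rfl, h4.imp fun w hw ↦ ⟨hw, dvd_zero _⟩⟩

theorem IsStronglyAdmissible.add (hc : IsStronglyAdmissible ℓ e s k c)
    (hd : IsStronglyAdmissible ℓ e s k d) : IsStronglyAdmissible ℓ e s k (c + d) := fun j ↦ by
  rw [Polynomial.coeff_add]
  refine ⟨fun h ↦ by rw [(hc j).1 h, (hd j).1 h, add_zero], ?_⟩
  obtain ⟨v, hv, hv'⟩ := (hc j).2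
  obtain ⟨w, hw, hw'⟩ := (hd j).2
  rcases le_total v w with h | h
  · exact ⟨v, hv, dvd_add hv' ((pow_dvd_pow _ h).trans hw')⟩
  · exact ⟨w, hw, dvd_add ((pow_dvd_pow _ h).trans hv') hw'⟩

theorem IsStronglyAdmissible.mul (hs : 0 < s) (hc : IsStronglyAdmissible ℓ e s m c)
    (hd : IsAdmissible ℓ e s k d) : IsAdmissible ℓ e s (k + m) (c * d) := fun j ↦ by
  rw [Polynomial.coeff_mul]
  have key : ∀ p ∈ antidiagonal j, (ℓ * j < e * (k + m) → c.coeff p.1 * d.coeff p.2 = 0) ∧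
      (ℓ : ℤ) ^ ((ℓ * j - e * (k + m) - 1) / s) ∣ c.coeff p.1 * d.coeff p.2 := by
    intro p hp
    rw [HasAntidiagonal.mem_antidiagonal] at hp
    rw [← hp, mul_add, mul_add]
    obtain ⟨h1, v, h2, h3⟩ := hc p.1
    obtain ⟨h4, h5⟩ := hd p.2
    by_cases h6 : ℓ * p.1 < e * m
    · simp [h1 h6]
    by_cases h7 : ℓ * p.2 < e * k
    · simp [h4 h7]
    refine ⟨fun h ↦ by omega, ?_⟩
    refine dvd_trans (pow_dvd_pow _ ?_) ((pow_add (ℓ : ℤ) _ _).symm ▸ mul_dvd_mul h3 h5)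
    rw [← Nat.mul_add_div hs]
    exact (Nat.div_le_div_right (by omega))
  exact ⟨fun h ↦ sum_eq_zero fun p hp ↦ (key p hp).1 h, dvd_sum fun p hp ↦ (key p hp).2⟩

end Valuation

section Trace

variable {K : Type*} [Field K] {ℓ : ℕ}

/-- The value at the power series `t` of an integer polynomial. -/
noncomputable def evalAt (t : K⟦X⟧) : Polynomial ℤ →+* K⟦X⟧ :=
  Polynomial.eval₂RingHom (Int.castRingHom _) t

theorem evalAt_X (t : K⟦X⟧) : evalAt t Polynomial.X = t := by simp [evalAt]

theorem evalAt_C (t : K⟦X⟧) (n : ℤ) : evalAt t (Polynomial.C n) = n := by simp [evalAt]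

/-- If `ξ` satisfies an equation whose coefficients are strongly admissible polynomials in
`expand ℓ t`, then the images under `U` of the powers of `ξ` are admissible polynomials in `t`. -/
theorem exists_evalAt_eq_atkinU_pow [CharZero K] {ω : K} (hℓ : ℓ.Prime) (hω : IsPrimitiveRoot ω ℓ)
    {ξ t : K⟦X⟧} {d e s : ℕ} (hs : 0 < s) (hd : d.Coprime ℓ) (hξ : coeff d ξ = 1)
    {κ : ℕ → Polynomial ℤ}
    (hκ : ξ ^ ℓ = ∑ b ∈ range ℓ, expand ℓ hℓ.ne_zero (evalAt t (κ (ℓ - b))) * ξ ^ b)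
    (hS : ∀ a, 1 ≤ a → a ≤ ℓ → IsStronglyAdmissible ℓ e s a (κ a))
    (hA : ∀ a, 1 ≤ a → a < ℓ → ∃ κ', (ℓ : Polynomial ℤ) * κ' = a * κ a ∧ IsAdmissible ℓ e s a κ') (k : ℕ) :
    ∃ c, IsAdmissible ℓ e s k c ∧ evalAt t c = atkinU K ℓ (ξ ^ k) := by
  induction k using Nat.strong_induction_on with
  | _ k ih =>
  choose! c hc hc' using ih
  rcases Nat.eq_zero_or_pos k with rfl | hk
  · refine ⟨Polynomial.C 1 * Polynomial.X ^ 0, IsAdmissible.monomial (by simp) (by simp), ?_⟩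
    simp only [map_one, pow_zero, mul_one]
    ext n
    rw [coeff_atkinU, coeff_one, coeff_one]
    simp [hℓ.ne_zero]
  rcases lt_or_ge k ℓ with h | h
  · obtain ⟨κ', hκ', hκ''⟩ := hA k hk h
    refine ⟨κ' + ∑ a ∈ range (k - 1), κ (a + 1) * c (k - (a + 1)),
      hκ''.add (IsAdmissible.sum fun a ha ↦ ?_), ?_⟩
    · rw [mem_range] at ha
      have := (hS (a + 1) (by omega) (by omega)).mul hs (hc (k - (a + 1)) (by omega))
      rwa [Nat.sub_add_cancel (by omega)] at this
    · let F : Polynomial K⟦X⟧ := .X ^ ℓ -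
        ∑ b ∈ range ℓ, .C (expand ℓ hℓ.ne_zero (evalAt t (κ (ℓ - b)))) * .X ^ b
      have hdeg : (∑ b ∈ range ℓ, Polynomial.C (expand ℓ hℓ.ne_zero (evalAt t (κ (ℓ - b)))) *
          .X ^ b).degree < ℓ := by
        refine lt_of_le_of_lt (Polynomial.degree_sum_le _ _) ?_
        refine (Finset.sup_lt_iff (WithBot.bot_lt_coe ℓ)).2 fun b hb ↦ ?_
        refine (Polynomial.degree_C_mul_X_pow_le _ _).trans_lt ?_
        rw [mem_range] at hb
        exact Nat.cast_lt.2 hb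
      have hm : F.Monic := Polynomial.monic_X_pow_sub hdeg
      have hnd : F.natDegree = ℓ := by
        refine Polynomial.natDegree_eq_of_degree_eq_some ?_
        rw [Polynomial.degree_sub_eq_left_of_degree_lt (by rwa [Polynomial.degree_X_pow]),
          Polynomial.degree_X_pow]
      have hcoeff : ∀ a, 1 ≤ a → a ≤ ℓ → F.coeff (ℓ - a) = -expand ℓ hℓ.ne_zero (evalAt t (κ a)) := by
        intro a ha ha'
        simp only [F]
        rw [Polynomial.coeff_sub, Polynomial.coeff_X_pow, if_neg (by omega),
          Polynomial.finsetSum_coeff, sum_eq_single (ℓ - a)]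
        · simp [Nat.sub_sub_self ha']
        · intro b _ hb
          rw [Polynomial.coeff_C_mul_X_pow, if_neg hb.symm]
        · intro hn
          exact absurd (mem_range.2 (by omega)) hn
      have hroot : ∀ i, F.eval (rescale (ω ^ i) ξ) = 0 := by
        intro i
        have := congrArg (rescale (ω ^ i)) hκ
        simp only [map_sum, map_mul, map_pow, rescale_expand hω.pow_eq_one] at this
        simp only [F]
        rw [Polynomial.eval_sub, Polynomial.eval_pow, Polynomial.eval_X, this,
          Polynomial.eval_finsetSum]
        simp
      have key := natCast_mul_expand_atkinU_pow hℓ hω hm hnd hd hξ hroot hk h.le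
      apply expand_injective hℓ.ne_zero
      apply mul_left_cancel₀ (natCast_ne_zero (K := K) hℓ.ne_zero)
      rw [key, hcoeff k hk h.le, map_add, map_add, mul_add]
      have h1 := congrArg (fun f ↦ expand ℓ hℓ.ne_zero (evalAt t f)) hκ'
      simp only [map_mul, map_natCast] at h1
      rw [h1, mul_neg, neg_neg, sub_eq_add_neg, ← sum_neg_distrib, map_sum, map_sum, mul_sum]
      congr 1
      refine sum_congr rfl fun a ha ↦ ?_
      rw [mem_range] at ha
      rw [hcoeff (a + 1) (by omega) (by omega), map_mul, map_mul, hc' _ (by omega)]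
      ring
  · refine ⟨∑ b ∈ range ℓ, κ (ℓ - b) * c (k - ℓ + b), IsAdmissible.sum fun b hb ↦ ?_, ?_⟩
    · rw [mem_range] at hb
      have := (hS (ℓ - b) (by omega) (by omega)).mul hs (hc (k - ℓ + b) (by omega))
      rwa [show k - ℓ + b + (ℓ - b) = k by omega] at this
    · rw [← Nat.sub_add_cancel h, pow_add, hκ, mul_sum, map_sum, map_sum, Nat.sub_add_cancel h]
      refine sum_congr rfl fun b hb ↦ ?_
      rw [mem_range] at hb
      rw [map_mul, hc' _ (by omega), mul_left_comm, ← pow_add, mul_comm, mul_comm (expand _ _ _),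
        atkinU_mul_expand hℓ hω]

end Trace

section Expansion

variable {K : Type*} [Field K] {ℓ m : ℕ} {t f : K⟦X⟧}

/-- The power series `f` is an integer polynomial in `t` without constant term, whose `j`-th
coefficient is divisible by `ℓ ^ (m + j - 1)`. -/
def HasDivisibleExpansion (ℓ : ℕ) (t : K⟦X⟧) (m : ℕ) (f : K⟦X⟧) : Prop :=
  ∃ c, evalAt t c = f ∧ c.coeff 0 = 0 ∧ ∀ j, (ℓ : ℤ) ^ (m + j) ∣ ℓ * c.coeff j

theorem evalAt_eq_sum (t : K⟦X⟧) (c : Polynomial ℤ) :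
    evalAt t c = ∑ i ∈ c.support, c.coeff i • t ^ i := by
  conv_lhs => rw [c.as_sum_support_C_mul_X_pow]
  simp only [map_sum, map_mul, map_pow, evalAt_X, evalAt_C, zsmul_eq_mul]

theorem HasDivisibleExpansion.map (hf : HasDivisibleExpansion ℓ t m f) (Φ : K⟦X⟧ →+ K⟦X⟧) (δ : ℕ)
    (hΦ : ∀ i, 1 ≤ i → ∃ b, evalAt t b = Φ (t ^ i) ∧ b.coeff 0 = 0 ∧
      ∀ j, (ℓ : ℤ) ^ (j + δ) ∣ ℓ ^ i * b.coeff j) :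
    HasDivisibleExpansion ℓ t (m + δ) (Φ f) := by
  obtain ⟨c, rfl, h0, hc⟩ := hf
  choose! b hb hb0 hbj using hΦ
  have hpos : ∀ i ∈ c.support, 1 ≤ i := by
    intro i hi
    rw [Polynomial.mem_support_iff] at hi
    exact Nat.one_le_iff_ne_zero.2 fun h ↦ hi (h ▸ h0)
  refine ⟨∑ i ∈ c.support, Polynomial.C (c.coeff i) * b i, ?_, ?_, fun j ↦ ?_⟩
  · rw [evalAt_eq_sum t c, map_sum, map_sum]
    refine sum_congr rfl fun i hi ↦ ?_
    rw [map_mul, evalAt_C, hb i (hpos i hi), map_zsmul, zsmul_eq_mul]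
  · rw [Polynomial.finsetSum_coeff]
    refine sum_eq_zero fun i hi ↦ ?_
    rw [Polynomial.coeff_C_mul, hb0 i (hpos i hi), mul_zero]
  · rw [Polynomial.finsetSum_coeff, mul_sum]
    refine dvd_sum fun i hi ↦ ?_
    obtain ⟨z, hz⟩ := hc i
    rw [Polynomial.coeff_C_mul, ← mul_assoc, hz,
      show (ℓ : ℤ) ^ (m + i) * z * (b i).coeff j = ℓ ^ m * (ℓ ^ i * (b i).coeff j) * z by ring,
      show m + δ + j = m + (j + δ) by ring, pow_add (ℓ : ℤ) m]
    exact dvd_mul_of_dvd_left (mul_dvd_mul_left _ (hbj i (hpos i hi) j)) _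

theorem exists_evalAt_eq_of_pow_mul (ht : t ≠ 0) {c : Polynomial ℤ} {i : ℕ}
    (hc : evalAt t c = t ^ i * f) (hi : ∀ j < i, c.coeff j = 0) :
    ∃ a, evalAt t a = f ∧ ∀ j, a.coeff j = c.coeff (i + j) := by
  obtain ⟨a, rfl⟩ := Polynomial.X_pow_dvd_iff.2 hi
  refine ⟨a, ?_, fun j ↦ ?_⟩
  · rw [map_mul, map_pow, evalAt_X] at hc
    exact mul_left_cancel₀ (pow_ne_zero _ ht) hc
  · rw [add_comm, Polynomial.coeff_X_pow_mul]

theorem exists_evalAt_eq_atkinU [CharZero K] {ω : K} (hℓ : ℓ.Prime) (hω : IsPrimitiveRoot ω ℓ)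
    {ξ : K⟦X⟧} (ht : t ≠ 0) {e s h : ℕ} (hξ : ξ ^ h = expand ℓ hℓ.ne_zero t * t)
    (hU : ∀ k, ∃ c, IsAdmissible ℓ e s k c ∧ evalAt t c = atkinU K ℓ (ξ ^ k))
    (hh : ℓ < e * h) (i r : ℕ) :
    ∃ a, evalAt t a = atkinU K ℓ (ξ ^ r * t ^ i) ∧
      ∀ j, (ℓ * (i + j) < e * (h * i + r) → a.coeff j = 0) ∧
        (ℓ : ℤ) ^ ((ℓ * (i + j) - e * (h * i + r) - 1) / s) ∣ a.coeff j := by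
  obtain ⟨c, hc, hc'⟩ := hU (h * i + r)
  have h1 : ξ ^ (h * i + r) = ξ ^ r * t ^ i * expand ℓ hℓ.ne_zero (t ^ i) := by
    rw [pow_add, pow_mul, hξ, mul_pow, map_pow]
    ring
  rw [h1, atkinU_mul_expand hℓ hω, mul_comm] at hc'
  obtain ⟨a, ha, ha'⟩ := exists_evalAt_eq_of_pow_mul ht hc' fun j hj ↦ (hc j).1 (by
    calc ℓ * j ≤ ℓ * i := Nat.mul_le_mul_left _ hj.le
      _ < e * h * i := Nat.mul_lt_mul_of_pos_right hh (by omega)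
      _ ≤ e * (h * i + r) := by rw [mul_add, mul_assoc]; exact Nat.le_add_right _ _)
  exact ⟨a, ha, fun j ↦ by rw [ha']; exact hc (i + j)⟩

/-- The data describing the action of Atkin's operator `U` on polynomials in a Hauptmodul `t`, for
a multiplier `ξ`. -/
structure IsAtkinPair (ℓ : ℕ) (ξ t : K⟦X⟧) : Prop where
  ne_zero : t ≠ 0
  atkinU_pow : ∀ i, 1 ≤ i → ∃ b, evalAt t b = atkinU K ℓ (t ^ i) ∧ b.coeff 0 = 0 ∧
    ∀ j, (ℓ : ℤ) ^ (j + 1) ∣ ℓ ^ i * b.coeff j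
  atkinU_mul_pow : ∀ i, 1 ≤ i → ∃ b, evalAt t b = atkinU K ℓ (ξ ^ 2 * t ^ i) ∧ b.coeff 0 = 0 ∧
    ∀ j, (ℓ : ℤ) ^ (j + 0) ∣ ℓ ^ i * b.coeff j
  atkinU_sq : HasDivisibleExpansion ℓ t 0 (atkinU K ℓ (ξ ^ 2))

theorem isAtkinPair_of_admissible [CharZero K] {ω : K} (hℓ : ℓ.Prime) (hω : IsPrimitiveRoot ω ℓ)
    {ξ : K⟦X⟧} (ht : t ≠ 0) {e s h : ℕ} (hξ : ξ ^ h = expand ℓ hℓ.ne_zero t * t)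
    (hU : ∀ k, ∃ c, IsAdmissible ℓ e s k c ∧ evalAt t c = atkinU K ℓ (ξ ^ k))
    (hparam : (ℓ = 5 ∧ e = 1 ∧ s = 2 ∧ h = 6) ∨ (ℓ = 7 ∧ e = 2 ∧ s = 4 ∧ h = 4)) :
    IsAtkinPair ℓ ξ t := by
  have key := exists_evalAt_eq_atkinU hℓ hω ht hξ hU
    (by obtain ⟨rfl, rfl, rfl, rfl⟩ | ⟨rfl, rfl, rfl, rfl⟩ := hparam <;> norm_num)
  refine ⟨ht, fun i hi ↦ ?_, fun i hi ↦ ?_, ?_⟩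
  · obtain ⟨a, ha, ha'⟩ := key i 0
    rw [pow_zero, one_mul] at ha
    have h0 : a.coeff 0 = 0 := (ha' 0).1 (by
      obtain ⟨rfl, rfl, rfl, rfl⟩ | ⟨rfl, rfl, rfl, rfl⟩ := hparam <;> omega)
    refine ⟨a, ha, h0, fun j ↦ ?_⟩
    rcases Nat.eq_zero_or_pos j with rfl | hj
    · simp [h0]
    rcases lt_or_ge (ℓ * (i + j)) (e * (h * i + 0)) with h1 | h1
    · simp [(ha' j).1 h1]
    refine dvd_trans (pow_dvd_pow _ ?_) ((pow_add (ℓ : ℤ) _ _).symm ▸ mul_dvd_mul_left _ (ha' j).2)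
    obtain ⟨rfl, rfl, rfl, rfl⟩ | ⟨rfl, rfl, rfl, rfl⟩ := hparam <;> omega
  · obtain ⟨a, ha, ha'⟩ := key i 2
    have h0 : a.coeff 0 = 0 := (ha' 0).1 (by
      obtain ⟨rfl, rfl, rfl, rfl⟩ | ⟨rfl, rfl, rfl, rfl⟩ := hparam <;> omega)
    refine ⟨a, ha, h0, fun j ↦ ?_⟩
    rcases Nat.eq_zero_or_pos j with rfl | hj
    · simp [h0]
    rcases lt_or_ge (ℓ * (i + j)) (e * (h * i + 2)) with h1 | h1
    · simp [(ha' j).1 h1]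
    refine dvd_trans (pow_dvd_pow _ ?_) ((pow_add (ℓ : ℤ) _ _).symm ▸ mul_dvd_mul_left _ (ha' j).2)
    obtain ⟨rfl, rfl, rfl, rfl⟩ | ⟨rfl, rfl, rfl, rfl⟩ := hparam <;> omega
  · obtain ⟨a, ha, ha'⟩ := key 0 2
    rw [pow_zero, mul_one] at ha
    have h0 : a.coeff 0 = 0 := (ha' 0).1 (by
      obtain ⟨rfl, rfl, rfl, rfl⟩ | ⟨rfl, rfl, rfl, rfl⟩ := hparam <;> omega)
    refine ⟨a, ha, h0, fun j ↦ ?_⟩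
    rcases Nat.eq_zero_or_pos j with rfl | hj
    · simp [h0]
    refine dvd_trans (pow_dvd_pow _ ?_) ((pow_succ' (ℓ : ℤ) _).symm ▸ mul_dvd_mul_left _ (ha' j).2)
    obtain ⟨rfl, rfl, rfl, rfl⟩ | ⟨rfl, rfl, rfl, rfl⟩ := hparam <;> omega

/-- The images of `1` under the iterates of `f ↦ U (U (ξ² f))`. -/
noncomputable def atkinIterate (ℓ : ℕ) (ξ : K⟦X⟧) : ℕ → K⟦X⟧
  | 0 => 1
  | r + 1 => atkinU K ℓ (atkinU K ℓ (ξ ^ 2 * atkinIterate ℓ ξ r))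

theorem IsAtkinPair.hasDivisibleExpansion {ξ : K⟦X⟧} (h : IsAtkinPair ℓ ξ t) (r : ℕ) :
    HasDivisibleExpansion ℓ t (r + 1) (atkinIterate ℓ ξ (r + 1)) := by
  have hU : ∀ {m f}, HasDivisibleExpansion ℓ t m f → HasDivisibleExpansion ℓ t (m + 1) (atkinU K ℓ f) :=
    fun hf ↦ hf.map (atkinU K ℓ).toAddMonoidHom 1 h.atkinU_pow
  induction r with
  | zero => simpa [atkinIterate] using hU h.atkinU_sq
  | succ r ih =>
    exact hU (ih.map ((atkinU K ℓ).toAddMonoidHom.comp (AddMonoidHom.mulLeft (ξ ^ 2))) 0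
      h.atkinU_mul_pow)

theorem IsAtkinPair.exists_atkinIterate_eq {ξ : K⟦X⟧} (h : IsAtkinPair ℓ ξ t) (hℓ : ℓ ≠ 0)
    (r : ℕ) : ∃ c, atkinIterate ℓ ξ r = (ℓ : K⟦X⟧) ^ r * evalAt t c := by
  cases r with
  | zero => exact ⟨1, by simp [atkinIterate]⟩
  | succ r =>
    obtain ⟨c, hc, h0, hcj⟩ := h.hasDivisibleExpansion r
    have : Polynomial.C ((ℓ : ℤ) ^ (r + 1)) ∣ c := by
      refine Polynomial.C_dvd_iff_dvd_coeff _ _ |>.2 fun j ↦ ?_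
      rcases Nat.eq_zero_or_pos j with rfl | hj
      · simp [h0]
      refine Int.dvd_of_mul_dvd_mul_left (Int.natCast_ne_zero.2 hℓ) ?_
      rw [← pow_succ']
      exact (pow_dvd_pow _ (by omega)).trans (hcj j)
    obtain ⟨b, rfl⟩ := this
    refine ⟨b, ?_⟩
    rw [← hc, map_mul, evalAt_C]
    push_cast
    rfl

end Expansion

section Hauptmodul

variable {K : Type*} [Field K] {ω : K} {E P : K⟦X⟧}

theorem constantCoeff_eq_one_of_mul_pentagonalSeries (hE : E = pentagonalSeries K)
    (hP : P * E = 1) : constantCoeff P = 1 := by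
  have := congrArg constantCoeff hP
  rwa [map_mul, hE, constantCoeff_pentagonalSeries, mul_one, map_one] at this

theorem X_mul_expand_pow_mul_pow_ne_zero {ℓ : ℕ} (hℓ : ℓ ≠ 0) (hP : P * E = 1) (k : ℕ) :
    X * expand ℓ hℓ E ^ k * P ^ k ≠ 0 := by
  have hQ : expand ℓ hℓ P * expand ℓ hℓ E = 1 := by rw [← map_mul, hP, map_one]
  exact mul_ne_zero (mul_ne_zero X_ne_zero (pow_ne_zero _ (right_ne_zero_of_mul_eq_one hQ)))
    (pow_ne_zero _ (left_ne_zero_of_mul_eq_one hP))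

theorem isAtkinPair_five [CharZero K] (hω : IsPrimitiveRoot ω 5) (hE : E = pentagonalSeries K)
    (hP : P * E = 1) : IsAtkinPair 5 (eulerShift K 5 (by norm_num) 1 * P)
      (X * expand 5 (by norm_num) E ^ 6 * P ^ 6) := by
  have hprime : Nat.Prime 5 := by norm_num
  have hξ := coeff_eulerShift_mul (d := 1) hprime.ne_zero
    (constantCoeff_eq_one_of_mul_pentagonalSeries hE hP)
  have ht0 := X_mul_expand_pow_mul_pow_ne_zero hprime.ne_zero hP 6
  obtain ⟨D, hD⟩ : ∃ D, D = eulerShift K 5 (by norm_num) 1 := ⟨_, rfl⟩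
  have hS := norm_equation_five hω hE hD
  have hD' : D = X * expand 5 hprime.ne_zero (expand 5 hprime.ne_zero E) := by
    rw [hD, hE, eulerShift, pow_one]
  have hQ : expand 5 hprime.ne_zero P * expand 5 hprime.ne_zero E = 1 := by
    rw [← map_mul, hP, map_one]
  rw [← hD] at hξ ⊢
  obtain ⟨t, ht⟩ : ∃ t, t = X * expand 5 hprime.ne_zero E ^ 6 * P ^ 6 := ⟨_, rfl⟩
  rw [← ht] at ht0 ⊢
  have hτ : expand 5 hprime.ne_zero t = X ^ 5 * expand 5 hprime.ne_zero
      (expand 5 hprime.ne_zero E) ^ 6 * expand 5 hprime.ne_zero P ^ 6 := by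
    rw [ht, map_mul, map_mul, map_pow, map_pow, expand_X]
  generalize hG : expand 5 hprime.ne_zero (expand 5 hprime.ne_zero E) = G at *
  generalize hF : expand 5 hprime.ne_zero E = F at *
  generalize hR : expand 5 hprime.ne_zero P = R at *
  have hτS : expand 5 hprime.ne_zero t * (E ^ 5 + 5 * D * E ^ 4 + 15 * D ^ 2 * E ^ 3 +
      25 * D ^ 3 * E ^ 2 + 25 * D ^ 4 * E) = D ^ 5 := by
    have h6 : (R * F) ^ 6 = 1 := by rw [hQ, one_pow]
    rw [hτ, hD'] at *
    linear_combination X ^ 5 * G ^ 5 * R ^ 6 * hS + X ^ 5 * G ^ 5 * h6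
  have hξ5 : (D * P) ^ 5 = expand 5 hprime.ne_zero t * (1 + 5 * (D * P) + 15 * (D * P) ^ 2 +
      25 * (D * P) ^ 3 + 25 * (D * P) ^ 4) := by
    have : (D * P) ^ 5 = expand 5 hprime.ne_zero t * ((P * E) ^ 5 + 5 * (D * P) * (P * E) ^ 4 +
        15 * (D * P) ^ 2 * (P * E) ^ 3 + 25 * (D * P) ^ 3 * (P * E) ^ 2 +
        25 * (D * P) ^ 4 * (P * E)) := by
      linear_combination -P ^ 5 * hτS
    rw [this, hP]
    ring
  have hξ6 : (D * P) ^ 6 = expand 5 hprime.ne_zero t * t := by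
    have h5 : D * P ^ 6 * D ^ 5 = expand 5 hprime.ne_zero t * t := by
      rw [← hτS]
      generalize expand 5 hprime.ne_zero t = τ at *
      rw [ht, hD']
      rw [hD'] at hS
      linear_combination τ * X * P ^ 6 * hS
    rw [← h5]
    ring
  have hU := exists_evalAt_eq_atkinU_pow (e := 1) (s := 2) hprime hω two_pos (by norm_num) hξ
    (κ := fun a ↦ Polynomial.C (([0, 25, 25, 15, 5, 1] : List ℤ).getD a 0) * Polynomial.X ^ 1)
    (t := t) ?_ ?_ ?_
  · exact isAtkinPair_of_admissible hprime hω ht0 hξ6 hU (by simp)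
  · rw [hξ5]
    simp only [map_mul, map_pow, evalAt_C, evalAt_X, map_intCast]
    simp [sum_range_succ]
    ring
  · intro a h1 h5
    have := fun v ↦ IsStronglyAdmissible.monomial (ℓ := 5) (e := 1) (s := 2) (k := a)
      (N := ([0, 25, 25, 15, 5, 1] : List ℤ).getD a 0) (i := 1) v
    interval_cases a
    · exact this 2 (by norm_num) (by norm_num) (by norm_num) two_pos
    · exact this 2 (by norm_num) (by norm_num) (by norm_num) two_pos
    · exact this 1 (by norm_num) (by norm_num) (by norm_num) two_pos
    · exact this 1 (by norm_num) (by norm_num) (by norm_num) two_pos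
    · exact this 0 (by norm_num) (by norm_num) (by norm_num) two_pos
  · intro a h1 h5
    refine ⟨Polynomial.C (([0, 5, 10, 9, 4] : List ℤ).getD a 0) * Polynomial.X ^ 1, ?_,
      IsAdmissible.monomial ?_ ?_⟩
    · rw [← map_natCast Polynomial.C, ← map_natCast Polynomial.C, ← mul_assoc, ← mul_assoc,
        ← map_mul, ← map_mul]
      congr 2
      interval_cases a <;> rfl
    · omega
    · interval_cases a <;> norm_num

theorem isAtkinPair_seven [CharZero K] (hω : IsPrimitiveRoot ω 7) (hE : E = pentagonalSeries K)
    (hP : P * E = 1) : IsAtkinPair 7 (eulerShift K 7 (by norm_num) 2 * P)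
      (X * expand 7 (by norm_num) E ^ 4 * P ^ 4) := by
  have hprime : Nat.Prime 7 := by norm_num
  have hξ := coeff_eulerShift_mul (d := 2) hprime.ne_zero
    (constantCoeff_eq_one_of_mul_pentagonalSeries hE hP)
  have ht0 := X_mul_expand_pow_mul_pow_ne_zero hprime.ne_zero hP 4
  obtain ⟨D, hD⟩ : ∃ D, D = eulerShift K 7 (by norm_num) 2 := ⟨_, rfl⟩
  have hD0 : D ≠ 0 := by
    rintro rfl
    rw [← hD] at hξ
    simp at hξ
  obtain ⟨V, hV⟩ : ∃ V, V = X * expand 7 hprime.ne_zero E ^ 4 := ⟨_, rfl⟩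
  have hS := norm_equation_seven hω hE hD hV
  have hD' : D = X ^ 2 * expand 7 hprime.ne_zero (expand 7 hprime.ne_zero E) := by
    rw [hD, hE, eulerShift]
  have hQ : expand 7 hprime.ne_zero P * expand 7 hprime.ne_zero E = 1 := by
    rw [← map_mul, hP, map_one]
  rw [← hD] at hξ ⊢
  obtain ⟨t, ht⟩ : ∃ t, t = X * expand 7 hprime.ne_zero E ^ 4 * P ^ 4 := ⟨_, rfl⟩
  rw [← ht] at ht0 ⊢
  have hτV : expand 7 hprime.ne_zero t * V = D ^ 4 := by
    rw [ht, map_mul, map_mul, map_pow, map_pow, expand_X, hV, hD']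
    have : (expand 7 hprime.ne_zero P * expand 7 hprime.ne_zero E) ^ 4 = 1 := by
      rw [hQ, one_pow]
    linear_combination X ^ 8 * expand 7 hprime.ne_zero (expand 7 hprime.ne_zero E) ^ 4 * this
  have hξ4 : (D * P) ^ 4 = expand 7 hprime.ne_zero t * t := by
    rw [mul_pow, ← hτV, mul_assoc, ht, hV]
  have hξ7 : (D * P) ^ 7 = expand 7 hprime.ne_zero t ^ 2 * (1 + 7 * (D * P) + 21 * (D * P) ^ 2 +
      49 * (D * P) ^ 3 + 147 * (D * P) ^ 4 + 343 * (D * P) ^ 5 + 343 * (D * P) ^ 6) +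
      expand 7 hprime.ne_zero t * (7 * (D * P) ^ 4 + 35 * (D * P) ^ 5 + 49 * (D * P) ^ 6) := by
    generalize expand 7 hprime.ne_zero t = τ at *
    have : (D * P) ^ 7 = τ ^ 2 * ((P * E) ^ 7 + 7 * (D * P) * (P * E) ^ 6 +
        21 * (D * P) ^ 2 * (P * E) ^ 5 + 49 * (D * P) ^ 3 * (P * E) ^ 4 +
        147 * (D * P) ^ 4 * (P * E) ^ 3 + 343 * (D * P) ^ 5 * (P * E) ^ 2 +
        343 * (D * P) ^ 6 * (P * E)) + τ * (7 * (D * P) ^ 4 * (P * E) ^ 3 +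
        35 * (D * P) ^ 5 * (P * E) ^ 2 + 49 * (D * P) ^ 6 * (P * E)) := by
      apply mul_left_cancel₀ hD0
      linear_combination -τ ^ 2 * P ^ 7 * hS + P ^ 7 * (τ * (7 * E ^ 3 * D + 35 * E ^ 2 * D ^ 2 +
        49 * E * D ^ 3) - τ * V - D ^ 4) * hτV
    rw [this, hP]
    ring
  have hU := exists_evalAt_eq_atkinU_pow (e := 2) (s := 4) hprime hω four_pos (by norm_num) hξ
    (κ := fun a ↦ Polynomial.C (([0, 343, 343, 147, 49, 21, 7, 1] : List ℤ).getD a 0) *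
      Polynomial.X ^ 2 + Polynomial.C (([0, 49, 35, 7] : List ℤ).getD a 0) * Polynomial.X ^ 1)
    (t := t) ?_ ?_ ?_
  · exact isAtkinPair_of_admissible hprime hω ht0 hξ4 hU (by simp)
  · rw [hξ7]
    simp only [map_mul, map_add, map_pow, evalAt_C, evalAt_X, map_intCast]
    simp [sum_range_succ]
    ring
  · intro a h1 h7
    have h2 := fun v ↦ IsStronglyAdmissible.monomial (ℓ := 7) (e := 2) (s := 4) (k := a)
      (N := ([0, 343, 343, 147, 49, 21, 7, 1] : List ℤ).getD a 0) (i := 2) v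
    have h3 := fun v ↦ IsStronglyAdmissible.monomial (ℓ := 7) (e := 2) (s := 4) (k := a)
      (N := ([0, 49, 35, 7] : List ℤ).getD a 0) (i := 1) v
    refine (h2 ([0, 3, 3, 2, 2, 1, 1, 0].getD a 0) ?_ ?_ ?_ four_pos).add
      (h3 ([0, 2, 1, 1].getD a 0) ?_ ?_ ?_ four_pos) <;> interval_cases a <;> norm_num
  · intro a h1 h7
    refine ⟨Polynomial.C (([0, 49, 98, 63, 28, 15, 6] : List ℤ).getD a 0) * Polynomial.X ^ 2 +
      Polynomial.C (([0, 7, 10, 3] : List ℤ).getD a 0) * Polynomial.X ^ 1, ?_,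
      (IsAdmissible.monomial ?_ ?_).add (IsAdmissible.monomial ?_ ?_)⟩
    · rw [← map_natCast Polynomial.C, ← map_natCast Polynomial.C, mul_add, mul_add, ← mul_assoc,
        ← mul_assoc, ← mul_assoc, ← mul_assoc, ← map_mul, ← map_mul, ← map_mul, ← map_mul]
      congr 3 <;> interval_cases a <;> rfl
    all_goals interval_cases a <;> norm_num

end Hauptmodul

section Conclusion

variable {K : Type*} [Field K] {ℓ : ℕ}

theorem map_pentagonalSeries :
    PowerSeries.map (Int.castRingHom K) (pentagonalSeries ℤ) = pentagonalSeries K := by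
  ext n
  simp only [pentagonalSeries, coeff_map, coeff_mk]
  split_ifs <;> simp

theorem evalAt_map (t : ℤ⟦X⟧) (c : Polynomial ℤ) :
    evalAt (PowerSeries.map (Int.castRingHom K) t) c =
      PowerSeries.map (Int.castRingHom K) (c.eval₂ (Int.castRingHom _) t) := by
  rw [Polynomial.hom_eval₂, evalAt, Polynomial.coe_eval₂RingHom]
  congr 1
  exact Subsingleton.elim _ _

/-- The iterates of the operator `f ↦ U (U (X ^ (2 d) f))` at `P²`. -/
noncomputable def squareIterate (ℓ d : ℕ) (P : K⟦X⟧) : ℕ → K⟦X⟧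
  | 0 => P ^ 2
  | r + 1 => atkinU K ℓ (atkinU K ℓ (X ^ (2 * d) * squareIterate ℓ d P r))

theorem atkinIterate_eq_sq_mul_squareIterate [CharZero K] {ω : K} (hℓ : ℓ.Prime)
    (hω : IsPrimitiveRoot ω ℓ) {E P : K⟦X⟧} (hE : E = pentagonalSeries K) (hP : P * E = 1)
    (d r : ℕ) :
    atkinIterate ℓ (eulerShift K ℓ hℓ.ne_zero d * P) r = squareIterate ℓ d P r * E ^ 2 := by
  induction r with
  | zero => rw [atkinIterate, squareIterate, ← mul_pow, hP, one_pow]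
  | succ r ih =>
    have h : (eulerShift K ℓ hℓ.ne_zero d * P) ^ 2 * (squareIterate ℓ d P r * E ^ 2) =
        X ^ (2 * d) * squareIterate ℓ d P r *
          expand ℓ hℓ.ne_zero (expand ℓ hℓ.ne_zero (E ^ 2)) := by
      have : (P * E) ^ 2 = 1 := by rw [hP, one_pow]
      rw [eulerShift, ← hE, map_pow, map_pow]
      linear_combination X ^ (2 * d) * squareIterate ℓ d P r *
        expand ℓ hℓ.ne_zero (expand ℓ hℓ.ne_zero E) ^ 2 * this
    rw [atkinIterate, ih, h, atkinU_mul_expand hℓ hω, atkinU_mul_expand hℓ hω, squareIterate]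

theorem coeff_squareIterate {d : ℕ} (hd : 24 * d + 1 = ℓ ^ 2) {P : K⟦X⟧}
    (hP : ∀ n, coeff n (P ^ 2) = (partp2 n : K)) (r : ℕ) {n N : ℕ} (hn : 1 ≤ n)
    (hN : 24 * N + 2 * ℓ ^ (2 * r) = 2 + 24 * n * ℓ ^ (2 * r)) :
    coeff n (squareIterate ℓ d P r) = (partp2 N : K) := by
  induction r generalizing n with
  | zero =>
    obtain rfl : N = n := by
      rw [mul_zero, pow_zero] at hN
      omega
    exact hP _
  | succ r ih =>
    rw [squareIterate, coeff_atkinU, coeff_atkinU, ← mul_assoc, ← sq, ← hd]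
    obtain ⟨k, hk⟩ : ∃ k, (24 * d + 1) * n = k + 2 * d := by
      refine ⟨(24 * d + 1) * n - 2 * d, (Nat.sub_add_cancel ?_).symm⟩
      nlinarith
    rw [hk, coeff_X_pow_mul]
    refine ih ?_ ?_
    · nlinarith
    · rw [mul_add, pow_add, mul_one, ← hd] at hN
      generalize ℓ ^ (2 * r) = q at *
      have h2 : 24 * (24 * d + 1) * n * q = 24 * (k + 2 * d) * q := by rw [← hk]; ring
      nlinarith

theorem pow_dvd_partp2 {ω : ℂ} (hℓ : ℓ.Prime) (hω : IsPrimitiveRoot ω ℓ) {d k : ℕ}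
    (hd : 24 * d + 1 = ℓ ^ 2)
    (h : ∀ {E P : ℂ⟦X⟧}, E = pentagonalSeries ℂ → P * E = 1 →
      IsAtkinPair ℓ (eulerShift ℂ ℓ hℓ.ne_zero d * P) (X * expand ℓ hℓ.ne_zero E ^ k * P ^ k))
    {r n N : ℕ} (hn : 1 ≤ n) (hN : 24 * N + 2 * ℓ ^ (2 * r) = 2 + 24 * n * ℓ ^ (2 * r)) :
    ℓ ^ r ∣ partp2 N := by
  let φ : ℤ⟦X⟧ →+* ℂ⟦X⟧ := PowerSeries.map (Int.castRingHom ℂ)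
  let P : ℤ⟦X⟧ := PowerSeries.mk fun n ↦ (partp n : ℤ)
  let t : ℤ⟦X⟧ := X * expand ℓ hℓ.ne_zero (pentagonalSeries ℤ) ^ k * P ^ k
  have hP : φ P * pentagonalSeries ℂ = 1 := by
    rw [← map_pentagonalSeries, ← map_mul, mk_partp_mul_pentagonalSeries, map_one]
  have hP2 : ∀ n, coeff n (φ P ^ 2) = (partp2 n : ℂ) := fun n ↦ by
    rw [← map_pow, ← mk_partp2_eq_sq]
    simp [φ]
  have ht : X * expand ℓ hℓ.ne_zero (pentagonalSeries ℂ) ^ k * φ P ^ k = φ t := by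
    simp only [t, φ, map_mul, map_pow, map_X, map_expand, map_pentagonalSeries]
  obtain ⟨c, hc⟩ := (h rfl hP).exists_atkinIterate_eq hℓ.ne_zero r
  rw [atkinIterate_eq_sq_mul_squareIterate hℓ hω rfl hP, ht, evalAt_map] at hc
  have hG : squareIterate ℓ d (φ P) r = φ (ℓ ^ r * (c.eval₂ (Int.castRingHom _) t * P ^ 2)) := by
    have h1 : (φ P * pentagonalSeries ℂ) ^ 2 = 1 := by rw [hP, one_pow]
    rw [map_mul, map_mul, map_pow, map_pow, map_natCast]
    linear_combination φ P ^ 2 * hc - squareIterate ℓ d (φ P) r * h1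
  have h2 := coeff_squareIterate hd hP2 r hn hN
  rw [hG, coeff_map, ← Nat.cast_pow, ← nsmul_eq_mul, map_nsmul, nsmul_eq_mul, eq_intCast] at h2
  have h3 : ((ℓ ^ r : ℕ) : ℤ) * coeff n (c.eval₂ (Int.castRingHom _) t * P ^ 2) = partp2 N := by
    exact_mod_cast h2
  exact Int.natCast_dvd_natCast.1 ⟨_, h3.symm⟩

/-- The congruence `24 N ≡ 2` puts `N` in the progression of the iterates of `U²`. -/
theorem exists_eq_of_modEq {q N : ℕ} (hq : q % 24 = 1) (h : 24 * N ≡ 2 [MOD q]) (hq1 : 1 < q) :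
    ∃ n, 1 ≤ n ∧ 24 * N + 2 * q = 2 + 24 * n * q := by
  obtain ⟨w, hw⟩ := (Nat.modEq_iff_dvd.1 h)
  push_cast at hw
  obtain ⟨a, rfl⟩ : ∃ a, q = 24 * a + 1 := ⟨q / 24, by omega⟩
  obtain ⟨u, rfl⟩ : ∃ u : ℤ, w = 2 - 24 * u := by
    refine ⟨N + a * w, ?_⟩
    push_cast at hw
    linarith
  have hu : 1 ≤ u := by
    by_contra! hu
    push_cast at hw
    nlinarith
  lift u to ℕ using by omega
  refine ⟨u, by omega, ?_⟩
  zify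
  push_cast at hw
  linarith

end Conclusion

end AtkinTwoColored

/-- Atkin's congruence for `p₂`, for `ℓ ∈ {5,7}`: if `24n ≡ 2 (mod ℓ^j)` then
`ℓ^⌊j/2-1⌋ ∣ p₂(n)` (the exponent `⌊j/2-1⌋` is `j/2 - 1` in truncated
natural-number arithmetic, i.e. `0` when `j = 1`). -/
theorem stmt10 (ℓ n j : ℕ) (hℓ : ℓ = 5 ∨ ℓ = 7) (hj : 1 ≤ j)
    (h : 24 * n ≡ 2 [MOD ℓ ^ j]) :
    ℓ ^ (j / 2 - 1) ∣ partp2 n := by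
  rcases Nat.eq_zero_or_pos (j / 2) with hr | hr
  · simp [hr]
  refine (pow_dvd_pow _ (Nat.sub_le _ _)).trans ?_
  replace h : 24 * n ≡ 2 [MOD ℓ ^ (2 * (j / 2))] := h.of_dvd (pow_dvd_pow _ (Nat.mul_div_le _ _))
  have hq : ℓ ^ (2 * (j / 2)) % 24 = 1 := by
    rw [pow_mul, Nat.pow_mod]
    rcases hℓ with rfl | rfl <;> simp
  have hq1 : 1 < ℓ ^ (2 * (j / 2)) := Nat.one_lt_pow (by omega) (by omega)
  obtain ⟨m, hm, hN⟩ := AtkinTwoColored.exists_eq_of_modEq hq h hq1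
  rcases hℓ with rfl | rfl
  · have hω := Complex.isPrimitiveRoot_exp 5 (by norm_num)
    exact AtkinTwoColored.pow_dvd_partp2 (d := 1) (by norm_num) hω (by norm_num) 
      (AtkinTwoColored.isAtkinPair_five hω) hm hN
  · have hω := Complex.isPrimitiveRoot_exp 7 (by norm_num)
    exact AtkinTwoColored.pow_dvd_partp2 (d := 2) (by norm_num) hω (by norm_num) 
      (AtkinTwoColored.isAtkinPair_seven hω) hm hN
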